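/- arXiv:physics/9908037 — 11 statements merged into one kernel-verified Lean document; each statement's English description precedes it below -/
import Mathlib

section
/- Let r₀ > 0, let q : ℝ → ℝ be real-analytic at r₀ with q′(r₀) ≠ 0, and let 𝐫 : ℝ → ℝ² be real-analytic at q₀ := q(r₀) and satisfy ‖𝐫(q(r))‖ = r for all r in a neighborhood of r₀. Let m be an integer and let Ψ : ℝ² → ℂ be equivariant of weight m. Then Ψ is real-analytic at the point 𝐫(q₀) ∈ ℝ² if and only if the internal wave function χ : ℝ → ℂ, χ(s) = Ψ(𝐫(s)), is real-analytic at q₀. (This is Theorem 2, part (i): away from the two-body collision, analyticity of the external wave function is equivalent to analyticity of the internal wave function.) -/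
open Filter Topology

/-- Counterclockwise rotation of the plane by angle `α`. -/
noncomputable def rot (α : ℝ) (x : ℝ × ℝ) : ℝ × ℝ :=
  (Real.cos α * x.1 - Real.sin α * x.2, Real.sin α * x.1 + Real.cos α * x.2)

/-- Euclidean norm on the plane. -/
noncomputable def nrm (x : ℝ × ℝ) : ℝ := Real.sqrt (x.1 ^ 2 + x.2 ^ 2)

/-- A wave function `Ψ : ℝ² → ℂ` is equivariant of weight `m` if
`Ψ(R_α x) = e^{i m α} Ψ(x)` for all angles `α` and points `x`. -/
def Equivariant (m : ℤ) (Ψ : ℝ × ℝ → ℂ) : Prop :=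
  ∀ (α : ℝ) (x : ℝ × ℝ), Ψ (rot α x) = Complex.exp ((m : ℂ) * α * Complex.I) * Ψ x

/-- The plane as the complex numbers. -/
noncomputable def cplx (x : ℝ × ℝ) : ℂ := Complex.equivRealProdCLM.symm x

lemma cplx_eq (x : ℝ × ℝ) : cplx x = x.1 + x.2 * Complex.I := by
  simp [cplx, Complex.equivRealProdCLM_symm_apply]

lemma cplx_analytic (x : ℝ × ℝ) : AnalyticAt ℝ cplx x :=
  (Complex.equivRealProdCLM.symm : ℝ × ℝ →L[ℝ] ℂ).analyticAt x

lemma norm_cplx (x : ℝ × ℝ) : ‖cplx x‖ = nrm x := by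
  rw [cplx_eq, Complex.norm_add_mul_I, nrm]

lemma cplx_rot (α : ℝ) (x : ℝ × ℝ) :
    cplx (rot α x) = Complex.exp (α * Complex.I) * cplx x := by
  rw [cplx_eq, cplx_eq, Complex.exp_mul_I, rot]
  push_cast
  linear_combination (-Complex.sin α * x.2) * Complex.I_sq

lemma equivariant_eq {m : ℤ} {Ψ : ℝ × ℝ → ℂ} (hΨ : Equivariant m Ψ) {x y : ℝ × ℝ}
    (h : nrm x = nrm y) (hy : 0 < nrm y) : Ψ x = (cplx x / cplx y) ^ m * Ψ y := by
  have hy0 : cplx y ≠ 0 := by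
    rw [← norm_pos_iff, norm_cplx]; exact hy
  have hn : ‖cplx x / cplx y‖ = 1 := by
    rw [norm_div, norm_cplx, norm_cplx, h, div_self hy.ne']
  obtain ⟨α, hα⟩ := (Complex.norm_eq_one_iff _).1 hn
  have hx : x = rot α y := by
    apply Complex.equivRealProdCLM.symm.injective
    change cplx x = cplx (rot α y)
    rw [cplx_rot, hα, div_mul_cancel₀ _ hy0]
  rw [← hα, ← Complex.exp_int_mul, ← mul_assoc, ← hΨ, ← hx]

lemma nrm_analytic {x : ℝ × ℝ} (hx : 0 < nrm x) : AnalyticAt ℝ nrm x := by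
  have h0 : x.1 ^ 2 + x.2 ^ 2 ≠ 0 := (Real.sqrt_pos.1 hx).ne'
  apply ContDiffAt.analyticAt
  unfold nrm
  exact ContDiffAt.sqrt (by fun_prop) h0

/-- Theorem 2(i): away from the two-body collision, the external wave function is
real-analytic iff the internal wave function is real-analytic. -/
theorem stmt0 (r₀ : ℝ) (hr₀ : 0 < r₀)
    (q : ℝ → ℝ) (hq : AnalyticAt ℝ q r₀) (hq' : deriv q r₀ ≠ 0)
    (rv : ℝ → ℝ × ℝ) (hrv : AnalyticAt ℝ rv (q r₀))
    (hnorm : ∀ᶠ r in 𝓝 r₀, nrm (rv (q r)) = r)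
    (m : ℤ) (Ψ : ℝ × ℝ → ℂ) (hΨ : Equivariant m Ψ) :
    AnalyticAt ℝ Ψ (rv (q r₀)) ↔ AnalyticAt ℝ (fun s : ℝ => Ψ (rv s)) (q r₀) := by
  refine ⟨fun h => h.comp hrv, fun h => ?_⟩
  have h0 : nrm (rv (q r₀)) = r₀ := hnorm.self_of_nhds
  have hpos : 0 < nrm (rv (q r₀)) := by rw [h0]; exact hr₀
  set x₀ := rv (q r₀) with hx₀
  have hN : AnalyticAt ℝ nrm x₀ := nrm_analytic hpos
  have hQ : AnalyticAt ℝ (fun x => q (nrm x)) x₀ := AnalyticAt.fun_comp (by rwa [h0]) hN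
  have hR : AnalyticAt ℝ (fun x => rv (q (nrm x))) x₀ :=
    AnalyticAt.fun_comp (g := rv) (by simpa only [h0] using hrv) hQ
  have hX : AnalyticAt ℝ (fun x => Ψ (rv (q (nrm x)))) x₀ :=
    AnalyticAt.fun_comp (g := fun s => Ψ (rv s)) (by simpa only [h0] using h) hQ
  have hC : AnalyticAt ℝ (fun x => cplx (rv (q (nrm x)))) x₀ :=
    AnalyticAt.fun_comp (cplx_analytic _) hR
  have hc0 : cplx x₀ ≠ 0 := by
    rw [← norm_pos_iff, norm_cplx]; exact hpos
  have hc1 : cplx (rv (q (nrm x₀))) ≠ 0 := by rw [h0, ← hx₀]; exact hc0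
  have hW := ((cplx_analytic x₀).fun_div hC hc1).fun_zpow (n := m) (div_ne_zero hc0 hc1)
  refine (hW.fun_mul hX).congr ?_
  have ht : Tendsto nrm (𝓝 x₀) (𝓝 r₀) := by
    have := hN.continuousAt.tendsto
    rwa [h0] at this
  filter_upwards [ht.eventually hnorm, ht.eventually (lt_mem_nhds hr₀)] with x hx hx'
  exact (equivariant_eq hΨ hx.symm (hx.symm ▸ hx')).symm
end

section
/- Let q : ℝ → ℝ be real-analytic at 0, odd (q(−r) = −q(r)), with q′(0) ≠ 0, and let 𝐫 : ℝ → ℝ² be real-analytic at 0, odd (𝐫(−s) = −𝐫(s)), and satisfy ‖𝐫(q(r))‖ = r for all sufficiently small r ≥ 0. Let m be an integer and let Ψ : ℝ² → ℂ be equivariant of weight m. Then Ψ is real-analytic at the origin 0 ∈ ℝ² if and only if the internal wave function χ : ℝ → ℂ, χ(s) = Ψ(𝐫(s)), is real-analytic at 0 and its Taylor coefficients c_n = χ^{(n)}(0)/n! vanish for every n with n < |m| or n ≢ m (mod 2); i.e., χ(s) = Σ_{k≥0} a_k s^{|m|+2k} near 0. (This is Theorem 2, part (ii).) -/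
open Filter Topology

lemma even_analytic (K : ℝ → ℂ) (hK : AnalyticAt ℝ K 0) (he : ∀ᶠ s in 𝓝 (0:ℝ), K (-s) = K s) :
    ∃ H : ℝ → ℂ, AnalyticAt ℝ H 0 ∧ ∀ᶠ s in 𝓝 (0:ℝ), K s = H (s ^ 2) := by
  obtain ⟨p, hp⟩ := hK
  rw [hasFPowerSeriesAt_iff] at hp
  simp only [zero_add] at hp
  set c : ℕ → ℂ := fun n => p.coeff n with hc
  let H : ℝ → ℂ := fun t => ∑' n, t ^ n • c (2 * n)
  have hinj : Function.Injective (fun n : ℕ => 2 * n) := fun a b h => by simpa using h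
  refine ⟨H, ?_, ?_⟩
  · let p' : FormalMultilinearSeries ℝ ℝ ℂ :=
      fun n => ContinuousMultilinearMap.mkPiRing ℝ (Fin n) (c (2 * n))
    refine ⟨p', ?_⟩
    rw [hasFPowerSeriesAt_iff]
    have ht : Tendsto (fun t : ℝ => Real.sqrt |t|) (𝓝 0) (𝓝 0) := by
      have : Continuous (fun t : ℝ => Real.sqrt |t|) := by fun_prop
      simpa using this.tendsto 0
    filter_upwards [ht.eventually hp] with t ht
    have h1 := (ht.summable.norm).comp_injective hinj
    have h2 : Summable (fun n => t ^ n • c (2 * n)) := by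
      refine Summable.of_norm ?_
      refine h1.congr fun n => ?_
      simp only [hc, Function.comp_apply, norm_smul, norm_pow, Real.norm_eq_abs, pow_mul]
      rw [abs_of_nonneg (Real.sqrt_nonneg |t|), Real.sq_sqrt (abs_nonneg t)]
    have hpc : ∀ n, p'.coeff n = c (2 * n) := fun n => by
      simp [FormalMultilinearSeries.coeff, p', -FormalMultilinearSeries.apply_eq_prod_smul_coeff]
    simp only [hpc, zero_add]
    exact h2.hasSum
  · have hn : Tendsto (fun t : ℝ => -t) (𝓝 0) (𝓝 0) := by
      simpa using (continuous_neg (G := ℝ)).tendsto 0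
    filter_upwards [hp, hn.eventually hp, he] with s h1 h2 h3
    rw [h3] at h2
    have h4 := (h1.add h2).const_smul (1/2 : ℝ)
    have h5 : (1/2 : ℝ) • (K s + K s) = K s := by
      rw [← two_smul ℝ, smul_smul]; norm_num
    rw [h5, ← hinj.hasSum_iff] at h4
    · have h6 : HasSum (fun n => (s ^ 2) ^ n • c (2 * n)) (K s) := by
        refine (congrArg (fun F => HasSum F (K s)) (funext fun n => ?_)).mp h4
        simp only [Function.comp_apply, pow_mul, neg_sq, ← two_smul ℝ, smul_smul]
        simp only [hc]
        congr 1
        ring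
      exact h6.tsum_eq.symm
    · intro n hn
      have : Odd n := by
        rw [← Nat.not_even_iff_odd]
        rintro ⟨k, hk⟩
        exact hn ⟨k, by simp; omega⟩
      simp [this.neg_pow]

lemma trig_poly (n : ℕ) (B : MultilinearMap ℝ (fun _ : Fin n => ℝ × ℝ) ℂ) :
    ∃ P : Polynomial ℂ, P.natDegree ≤ 2 * n ∧ ∀ w : ℂ, ‖w‖ = 1 →
      w ^ n * B (fun _ => (w.re, w.im)) = P.eval w := by
  induction n with
  | zero =>
    refine ⟨Polynomial.C (B 0), by simp, fun w _ => ?_⟩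
    simp
    congr 1
    exact Subsingleton.elim _ _
  | succ n ih =>
    obtain ⟨P1, hd1, h1⟩ := ih (B.curryLeft (1, 0))
    obtain ⟨P2, hd2, h2⟩ := ih (B.curryLeft (0, 1))
    refine ⟨Polynomial.C (1/2) * (Polynomial.X ^ 2 + 1) * P1
      + Polynomial.C (-Complex.I/2) * (Polynomial.X ^ 2 - 1) * P2, ?_, fun w hw => ?_⟩
    · have e1 : (Polynomial.C (1/2 : ℂ) * (Polynomial.X ^ 2 + 1)).natDegree ≤ 2 := by compute_degree
      have e2 : (Polynomial.C (-Complex.I/2 : ℂ) * (Polynomial.X ^ 2 - 1)).natDegree ≤ 2 := by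
        compute_degree
      refine (Polynomial.natDegree_add_le _ _).trans (max_le ?_ ?_)
      · refine Polynomial.natDegree_mul_le.trans (by omega)
      · refine Polynomial.natDegree_mul_le.trans (by omega)
    · have hB : B (fun _ => (w.re, w.im)) = w.re * B.curryLeft (1, 0) (fun _ => (w.re, w.im))
          + w.im * B.curryLeft (0, 1) (fun _ => (w.re, w.im)) := by
        have e : (fun _ : Fin (n+1) => (w.re, w.im)) =
            Fin.cons (α := fun _ => ℝ × ℝ) (w.re, w.im) (fun _ => (w.re, w.im)) := by
          funext i; refine Fin.cases ?_ (fun j => ?_) i <;> simp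
        rw [e]
        have e3 : ((w.re, w.im) : ℝ × ℝ) = w.re • (1, 0) + w.im • (0, 1) := by simp
        rw [← MultilinearMap.curryLeft_apply]
        conv_lhs => arg 1; rw [e3, map_add, map_smul, map_smul]
        simp
      have hz : w * (starRingEnd ℂ) w = 1 := by
        rw [Complex.mul_conj, Complex.normSq_eq_norm_sq, hw]; simp
      have hre : w * (w.re : ℂ) = 1/2 * (w ^ 2 + 1) := by
        rw [Complex.re_eq_add_conj]; linear_combination (1/2) * hz
      have him : w * (w.im : ℂ) = -Complex.I/2 * (w ^ 2 - 1) := by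
        rw [Complex.im_eq_sub_conj]; field_simp
        rw [Complex.I_sq]; linear_combination -hz
      rw [hB]
      simp only [Polynomial.eval_add, Polynomial.eval_mul, Polynomial.eval_C, Polynomial.eval_pow,
        Polynomial.eval_X, Polynomial.eval_one, Polynomial.eval_sub, ← h1 w hw, ← h2 w hw, ← hre, ← him]
      ring

lemma coeff_zero (n : ℕ) (m : ℤ) (hnm : (n : ℤ) < |m|)
    (B : MultilinearMap ℝ (fun _ : Fin n => ℝ × ℝ) ℂ) (c : ℂ)
    (h : ∀ w : ℂ, ‖w‖ = 1 → B (fun _ => (w.re, w.im)) = w ^ m * c) : c = 0 := by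
  obtain ⟨P, hd, hP⟩ := trig_poly n B
  have hinf : Set.Infinite {w : ℂ | ‖w‖ = 1} := by
    have : {w : ℂ | ‖w‖ = 1} = Metric.sphere (0:ℂ) 1 := by ext; simp
    rw [this]
    have hpc : IsPreconnected (Metric.sphere (0:ℂ) 1) :=
      isPreconnected_sphere (by rw [Complex.rank_real_complex]; norm_num) 0 1
    exact hpc.infinite_of_nontrivial ⟨1, by simp, -1, by simp, by norm_num⟩
  rcases lt_or_ge m 0 with hm | hm
  · rw [abs_of_neg hm] at hnm
    obtain ⟨k, hk⟩ : ∃ k : ℕ, m = -(n + k + 1 : ℕ) := ⟨(-m - n - 1).toNat, by omega⟩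
    have : Polynomial.X ^ (k+1) * P = Polynomial.C c := by
      apply Polynomial.eq_of_infinite_eval_eq
      refine hinf.mono fun w hw => ?_
      have hw0 : w ≠ 0 := by rintro rfl; simp at hw
      simp only [Set.mem_ofPred_eq, Polynomial.eval_mul, Polynomial.eval_pow, Polynomial.eval_X,
        Polynomial.eval_C, ← hP w hw, h w hw, hk, zpow_neg, zpow_natCast]
      field_simp
      ring
    have := congrArg (Polynomial.eval 0) this
    simpa using this.symm
  · rw [abs_of_nonneg hm] at hnm
    lift m to ℕ using hm
    have : P = Polynomial.C c * Polynomial.X ^ (m + n) := by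
      apply Polynomial.eq_of_infinite_eval_eq
      refine hinf.mono fun w hw => ?_
      simp only [Set.mem_ofPred_eq, Polynomial.eval_mul, Polynomial.eval_pow, Polynomial.eval_X,
        Polynomial.eval_C, ← hP w hw, h w hw, zpow_natCast]
      ring
    have h2 := congrArg (fun p => Polynomial.coeff p (m + n)) this
    simp only [Polynomial.coeff_C_mul_X_pow] at h2
    rw [Polynomial.coeff_eq_zero_of_natDegree_lt (by omega)] at h2
    simpa using h2.symm

lemma equi_unit {m : ℤ} {Ψ : ℝ × ℝ → ℂ} (hΨ : Equivariant m Ψ) (w : ℂ) (hw : ‖w‖ = 1) (t : ℝ) :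
    Ψ (t * w.re, t * w.im) = w ^ m * Ψ (t, 0) := by
  have hz := Complex.norm_mul_exp_arg_mul_I w
  rw [hw] at hz
  have hw0 : w ≠ 0 := by rintro rfl; simp at hw
  have h := hΨ w.arg (t, 0)
  have e : rot w.arg (t, 0) = (t * w.re, t * w.im) := by
    simp [rot, Complex.cos_arg hw0, Complex.sin_arg, hw, mul_comm]
  rw [e] at h
  rw [h]
  congr 1
  conv_rhs => rw [← hz]
  simp [← Complex.exp_int_mul, mul_assoc]

lemma order_of_bigO (g : ℝ → ℂ) (hg : AnalyticAt ℝ g 0) (N : ℕ)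
    (h : g =O[𝓝 0] fun s : ℝ => ‖s‖ ^ N) : (N : ℕ∞) ≤ analyticOrderAt g 0 := by
  by_contra hlt
  push Not at hlt
  have hne : analyticOrderAt g 0 ≠ ⊤ := ne_top_of_lt hlt
  obtain ⟨k, hk⟩ := ENat.ne_top_iff_exists.1 hne
  rw [← hk] at hlt
  have hlt' : k < N := by exact_mod_cast hlt
  obtain ⟨u, hu, hu0, hug⟩ := hg.analyticOrderAt_eq_natCast.1 hk.symm
  obtain ⟨C, hC⟩ := h.bound
  have h1 : ∀ᶠ s in 𝓝[≠] (0:ℝ), ‖u s‖ ≤ C * ‖s‖ ^ (N - k) := by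
    have := (hug.and hC).filter_mono (nhdsWithin_le_nhds (s := {0}ᶜ))
    filter_upwards [this, self_mem_nhdsWithin] with s ⟨h1, h2⟩ h3
    have hs : 0 < ‖s‖ := norm_pos_iff.2 h3
    rw [h1] at h2
    simp only [sub_zero, norm_smul, norm_pow, norm_norm] at h2
    have e : ‖s‖ ^ N = ‖s‖ ^ k * ‖s‖ ^ (N - k) := by rw [← pow_add]; congr 1; omega
    rw [e] at h2
    have : 0 < ‖s‖ ^ k := by positivity
    nlinarith
  have h2 : Tendsto (fun s => ‖u s‖) (𝓝[≠] 0) (𝓝 ‖u 0‖) :=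
    (hu.continuousAt.norm.tendsto).mono_left nhdsWithin_le_nhds
  have h3 : Tendsto (fun s : ℝ => C * ‖s‖ ^ (N - k)) (𝓝[≠] 0) (𝓝 0) := by
    have : Continuous (fun s : ℝ => C * ‖s‖ ^ (N - k)) := by fun_prop
    have := this.tendsto 0
    have hnk : N - k ≠ 0 := by omega
    simp only [norm_zero, zero_pow hnk, mul_zero] at this
    exact this.mono_left nhdsWithin_le_nhds
  have := le_of_tendsto_of_tendsto h2 h3 h1
  exact hu0 (norm_le_zero_iff.1 this)

lemma polar (z : ℂ) : ∃ w : ℂ, ‖w‖ = 1 ∧ z = (‖z‖ : ℂ) * w := by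
  refine ⟨Complex.exp (z.arg * Complex.I), Complex.norm_exp_ofReal_mul_I _, ?_⟩
  exact (Complex.norm_mul_exp_arg_mul_I z).symm

lemma Psi_bigO {m : ℤ} {Ψ : ℝ × ℝ → ℂ} (hΨ : Equivariant m Ψ) (ha : AnalyticAt ℝ Ψ 0) :
    Ψ =O[𝓝 0] fun x : ℝ × ℝ => ‖x‖ ^ m.natAbs := by
  obtain ⟨p, hp⟩ := ha
  have key : ∀ w : ℂ, ‖w‖ = 1 → ∀ n, p n (fun _ => (w.re, w.im)) = w ^ m * p n (fun _ => (1, 0)) := by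
    intro w hw n
    let L : ℂ → ℝ →L[ℝ] ℝ × ℝ := fun w => ContinuousLinearMap.smulRight (1 : ℝ →L[ℝ] ℝ) (w.re, w.im)
    have hL : ∀ w, HasFPowerSeriesAt (Ψ ∘ L w) (p.compContinuousLinearMap (L w)) 0 := by
      intro w
      apply HasFPowerSeriesAt.compContinuousLinearMap
      simpa using hp
    have h1 := hL w
    have h2 := (hL 1).const_smul (c := w ^ m)
    have e : Ψ ∘ L w = w ^ m • (Ψ ∘ L 1) := by
      funext t
      have := equi_unit hΨ w hw t
      simpa [L] using this
    rw [e] at h1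
    have h3 := congrFun (h1.eq_formalMultilinearSeries h2) n
    have h4 := congrArg (fun q => q (fun _ => (1:ℝ))) h3
    simp only [FormalMultilinearSeries.compContinuousLinearMap_apply, Function.comp_def] at h4
    simpa [L, FormalMultilinearSeries.compContinuousLinearMap_apply, Function.comp_def,
      -FormalMultilinearSeries.apply_eq_prod_smul_coeff] using h4
  have hz : ∀ n < m.natAbs, ∀ x : ℝ × ℝ, p n (fun _ => x) = 0 := by
    intro n hn x
    have h0 := coeff_zero n m (by rw [Int.abs_eq_natAbs]; omega) (p n).toMultilinearMap _ (fun w hw => key w hw n)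
    obtain ⟨w, hw, hx⟩ := polar (⟨x.1, x.2⟩ : ℂ)
    set ρ := ‖(⟨x.1, x.2⟩ : ℂ)‖
    have hx' : x = ρ • ((w.re, w.im) : ℝ × ℝ) := by
      have h1 := congrArg Complex.re hx
      have h2 := congrArg Complex.im hx
      simp at h1 h2
      ext <;> simp [h1, h2]
    rw [hx']
    have := (p n).map_smul_univ (fun _ => ρ) (fun _ => ((w.re, w.im) : ℝ × ℝ))
    rw [this, key w hw n, h0]
    simp
  have := hp.isBigO_sub_partialSum_pow m.natAbs
  refine this.congr_left fun y => ?_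
  rw [FormalMultilinearSeries.partialSum, Finset.sum_eq_zero]
  · simp
  · intro i hi
    exact hz i (Finset.mem_range.1 hi) y

lemma unit_pow_mul (m : ℤ) (w : ℂ) (hw : ‖w‖ = 1) (ρ : ℝ) :
    w ^ m * (ρ : ℂ) ^ m.natAbs =
      if 0 ≤ m then ((ρ : ℂ) * w) ^ m.natAbs
      else ((starRingEnd ℂ) ((ρ : ℂ) * w)) ^ m.natAbs := by
  have hz : (starRingEnd ℂ) w = w⁻¹ := by
    apply eq_inv_of_mul_eq_one_right
    rw [Complex.mul_conj, Complex.normSq_eq_norm_sq, hw]; simp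
  split_ifs with h
  · obtain ⟨n, rfl⟩ := Int.eq_ofNat_of_zero_le h
    simp [mul_pow, mul_comm]
  · obtain ⟨n, rfl⟩ : ∃ n : ℕ, m = -n := ⟨(-m).toNat, by omega⟩
    simp [mul_pow, mul_comm, hz]

lemma Psi_neg {m : ℤ} {Ψ : ℝ × ℝ → ℂ} (hΨ : Equivariant m Ψ) (x : ℝ × ℝ) :
    Ψ (-x) = (-1) ^ m * Ψ x := by
  have h := hΨ Real.pi x
  have e : rot Real.pi x = -x := by ext <;> simp [rot]
  rw [e] at h
  rw [h, mul_assoc, Complex.exp_int_mul, Complex.exp_pi_mul_I]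

lemma forward {m : ℤ} {Ψ : ℝ × ℝ → ℂ} (hΨ : Equivariant m Ψ) (ha : AnalyticAt ℝ Ψ 0)
    (rv : ℝ → ℝ × ℝ) (hrv : AnalyticAt ℝ rv 0) (hrvodd : ∀ s : ℝ, rv (-s) = -rv s) :
    AnalyticAt ℝ (fun s : ℝ => Ψ (rv s)) 0 ∧
        ∀ n : ℕ, ((n : ℤ) < |m| ∨ ¬ (2 ∣ (m - n))) →
          iteratedDeriv n (fun s : ℝ => Ψ (rv s)) 0 = 0 := by
  have hr0 : rv 0 = 0 := by
    have := hrvodd 0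
    rw [neg_zero] at this
    exact self_eq_neg.1 this
  have hχ : AnalyticAt ℝ (fun s : ℝ => Ψ (rv s)) 0 := by
    rw [← hr0] at ha
    exact ha.comp hrv
  refine ⟨hχ, fun n hn => ?_⟩
  rcases hn with hn | hn
  · have h1 : (fun s : ℝ => Ψ (rv s)) =O[𝓝 0] fun s => ‖rv s‖ ^ m.natAbs := by
      have ht : Tendsto rv (𝓝 0) (𝓝 0) := by simpa [hr0] using hrv.continuousAt.tendsto
      exact (Psi_bigO hΨ ha).comp_tendsto ht
    have h2 : (fun s : ℝ => rv s) =O[𝓝 0] fun s => s := by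
      have := hrv.differentiableAt.isBigO_sub
      simpa [hr0] using this
    have h3 := h1.trans (h2.norm_left.norm_right.pow m.natAbs)
    have h4 := order_of_bigO _ hχ _ h3
    rw [natCast_le_analyticOrderAt_iff_iteratedDeriv_eq_zero hχ] at h4
    exact h4 n (by rw [Int.abs_eq_natAbs] at hn; omega)
  · have h1 : (fun s : ℝ => Ψ (rv (-s))) = fun s => (-1 : ℂ) ^ m * Ψ (rv s) := by
      funext s; rw [hrvodd, Psi_neg hΨ]
    have h2 := iteratedDeriv_comp_neg n (fun s : ℝ => Ψ (rv s)) 0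
    rw [h1, iteratedDeriv_const_mul_field, neg_zero] at h2
    set d := iteratedDeriv n (fun s : ℝ => Ψ (rv s)) 0
    rcases Int.even_or_odd m with he | ho
    · have hno : Odd n := by
        rw [← Nat.not_even_iff_odd]; rintro ⟨k, hk⟩; obtain ⟨j, hj⟩ := he
        exact hn ⟨j - k, by rw [hj, hk]; push_cast; ring⟩
      rw [he.neg_one_zpow, hno.neg_one_pow] at h2
      simp at h2
      exact self_eq_neg.1 h2
    · have hno : Even n := by
        rw [← Nat.not_odd_iff_even]; rintro ⟨k, hk⟩; obtain ⟨j, hj⟩ := ho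
        exact hn ⟨j - k, by rw [hj, hk]; push_cast; ring⟩
      rw [ho.neg_one_zpow, hno.neg_one_pow] at h2
      simp at h2
      exact self_eq_neg.1 h2.symm

lemma backward {m : ℤ} {Ψ : ℝ × ℝ → ℂ} (hΨ : Equivariant m Ψ)
    (q : ℝ → ℝ) (hq : AnalyticAt ℝ q 0) (hqodd : ∀ r : ℝ, q (-r) = -q r)
    (rv : ℝ → ℝ × ℝ) (hrv : AnalyticAt ℝ rv 0) (hrvodd : ∀ s : ℝ, rv (-s) = -rv s)
    (hnorm : ∀ᶠ r in 𝓝 (0 : ℝ), 0 ≤ r → nrm (rv (q r)) = r)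
    (hχ : AnalyticAt ℝ (fun s : ℝ => Ψ (rv s)) 0)
    (hd : ∀ n : ℕ, (n : ℤ) < |m| → iteratedDeriv n (fun s : ℝ => Ψ (rv s)) 0 = 0) :
    AnalyticAt ℝ Ψ 0 := by
  have hr0 : rv 0 = 0 := by
    have := hrvodd 0
    rw [neg_zero] at this
    exact self_eq_neg.1 this
  have hq0 : q 0 = 0 := by
    have := hqodd 0
    rw [neg_zero] at this
    exact self_eq_neg.1 this
  have hqt : Tendsto q (𝓝 0) (𝓝 0) := by simpa [hq0] using hq.continuousAt.tendsto
  set N := m.natAbs with hN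
  -- factorisations
  have hord : (N : ℕ∞) ≤ analyticOrderAt (fun s : ℝ => Ψ (rv s)) 0 := by
    rw [natCast_le_analyticOrderAt_iff_iteratedDeriv_eq_zero hχ]
    intro i hi
    exact hd i (by rw [Int.abs_eq_natAbs]; omega)
  obtain ⟨k, hk, hχk⟩ := (natCast_le_analyticOrderAt hχ).1 hord
  simp only [sub_zero] at hχk
  have hq1 : ((1 : ℕ) : ℕ∞) ≤ analyticOrderAt q 0 := by
    rw [natCast_le_analyticOrderAt_iff_iteratedDeriv_eq_zero hq]
    intro i hi
    obtain rfl : i = 0 := by omega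
    simpa using hq0
  obtain ⟨q1, hq1a, hqq⟩ := (natCast_le_analyticOrderAt hq).1 hq1
  simp only [sub_zero, pow_one, smul_eq_mul] at hqq
  let Z : ℝ → ℂ := fun r => ((rv (q r)).1 : ℂ) + ((rv (q r)).2 : ℂ) * Complex.I
  have hrq : AnalyticAt ℝ (fun r => rv (q r)) 0 := by
    rw [← hq0] at hrv
    exact hrv.comp hq
  have hof : ∀ x : ℝ, AnalyticAt ℝ (fun t : ℝ => (t : ℂ)) x := fun x =>
    Complex.ofRealCLM.analyticAt x
  have hZ : AnalyticAt ℝ Z 0 := by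
    have h1 : AnalyticAt ℝ (fun r => (rv (q r)).1) 0 := analyticAt_fst.comp hrq
    have h2 : AnalyticAt ℝ (fun r => (rv (q r)).2) 0 := analyticAt_snd.comp hrq
    exact ((hof _).comp h1).add (((hof _).comp h2).mul analyticAt_const)
  have hZ1 : ((1 : ℕ) : ℕ∞) ≤ analyticOrderAt Z 0 := by
    rw [natCast_le_analyticOrderAt_iff_iteratedDeriv_eq_zero hZ]
    intro i hi
    obtain rfl : i = 0 := by omega
    simp [Z, hq0, hr0]
  obtain ⟨v, hv, hZv⟩ := (natCast_le_analyticOrderAt hZ).1 hZ1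
  simp only [sub_zero, pow_one] at hZv
  have hZn : ∀ r, ‖Z r‖ = nrm (rv (q r)) := by
    intro r
    simp only [Z, nrm, Complex.norm_add_mul_I]
  have hnegt : Tendsto (fun t : ℝ => -t) (𝓝 0) (𝓝 0) := by
    simpa using (continuous_neg (G := ℝ)).tendsto 0
  have hZabs : ∀ᶠ r in 𝓝 (0:ℝ), ‖Z r‖ = |r| := by
    filter_upwards [hnorm, hnegt.eventually hnorm] with r h1 h2
    rcases le_or_gt 0 r with h | h
    · rw [hZn, h1 h, abs_of_nonneg h]
    · have := h2 (by linarith)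
      rw [hqodd, hrvodd] at this
      rw [hZn, abs_of_neg h, ← this]
      simp [nrm]
  have hv1' : ∀ᶠ r in 𝓝[≠] (0:ℝ), ‖v r‖ = 1 := by
    have := (hZv.and hZabs).filter_mono (nhdsWithin_le_nhds (s := {0}ᶜ))
    filter_upwards [this, self_mem_nhdsWithin] with r ⟨h1, h2⟩ h3
    rw [h1, norm_smul, Real.norm_eq_abs] at h2
    have : |r| ≠ 0 := abs_ne_zero.2 h3
    exact mul_left_cancel₀ this (by rw [h2, mul_one])
  have hv0 : ‖v 0‖ = 1 := by
    have h2 : Tendsto (fun s => ‖v s‖) (𝓝[≠] 0) (𝓝 ‖v 0‖) :=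
      (hv.continuousAt.norm.tendsto).mono_left nhdsWithin_le_nhds
    have h3 : Tendsto (fun s => ‖v s‖) (𝓝[≠] 0) (𝓝 1) :=
      tendsto_const_nhds.congr' (by filter_upwards [hv1'] with r hr using hr.symm)
    exact tendsto_nhds_unique h2 h3
  have hv1 : ∀ᶠ r in 𝓝 (0:ℝ), ‖v r‖ = 1 := by
    rw [eventually_nhdsWithin_iff] at hv1'
    filter_upwards [hv1'] with r hr
    by_cases h : r = 0
    · rw [h, hv0]
    · exact hr h
  have hvne : v 0 ≠ 0 := by intro h; rw [h] at hv0; simp at hv0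
  -- radial function
  let K : ℝ → ℂ := fun r => (v r)⁻¹ ^ m * ((q1 r : ℂ) ^ N * k (q r))
  have hK : AnalyticAt ℝ K 0 := by
    have h1 : AnalyticAt ℝ (fun r => (v r)⁻¹ ^ m) 0 :=
      (hv.inv hvne).zpow (inv_ne_zero hvne)
    have h2 : AnalyticAt ℝ (fun r => (q1 r : ℂ) ^ N) 0 := ((hof _).comp hq1a).pow N
    have h3 : AnalyticAt ℝ (fun r => k (q r)) 0 := by
      rw [← hq0] at hk
      exact hk.comp hq
    exact h1.mul (h2.mul h3)
  have hfK : ∀ᶠ r in 𝓝 (0:ℝ), Ψ (r, 0) = (r : ℂ) ^ N * K r := by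
    filter_upwards [hv1, hZv, hqq, hqt.eventually hχk] with r h1 h2 h3 h4
    have e : rv (q r) = (r * (v r).re, r * (v r).im) := by
      have e1 := congrArg Complex.re h2
      have e2 := congrArg Complex.im h2
      simp [Z] at e1 e2
      ext <;> simp [e1, e2]
    rw [e, equi_unit hΨ _ h1] at h4
    have hvr : v r ≠ 0 := by intro h; rw [h] at h1; simp at h1
    have h5 : Ψ (r, 0) = (v r)⁻¹ ^ m * (q r ^ N • k (q r)) := by
      rw [← h4, ← mul_assoc, inv_zpow, inv_mul_cancel₀ (zpow_ne_zero _ hvr), one_mul]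
    rw [h5]
    simp only [K, Complex.real_smul]
    nth_rw 1 [h3]
    push_cast
    ring
  have heven : ∀ᶠ r in 𝓝 (0:ℝ), K (-r) = K r := by
    filter_upwards [hfK, hnegt.eventually hfK] with r h1 h2
    by_cases hr : r = 0
    · simp [hr]
    have h3 := Psi_neg hΨ (r, 0)
    have e : (-(r, 0) : ℝ × ℝ) = (-r, 0) := by simp
    rw [e, h1, h2] at h3
    have e2 : ((-1 : ℂ)) ^ m = (-1) ^ N := by
      rcases Int.natAbs_eq m with h | h
      · rw [h, zpow_natCast]
      · rw [h, zpow_neg, zpow_natCast, ← inv_pow]; norm_num [hN]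
    rw [e2] at h3
    push_cast at h3
    rw [neg_pow, mul_assoc] at h3
    have hr' : (r : ℂ) ^ N ≠ 0 := pow_ne_zero _ (by exact_mod_cast hr)
    have h1' : ((-1 : ℂ)) ^ N ≠ 0 := pow_ne_zero _ (by norm_num)
    exact mul_left_cancel₀ hr' (mul_left_cancel₀ h1' h3)
  obtain ⟨H, hH, hKH⟩ := even_analytic K hK heven
  -- global formula
  let W : ℝ × ℝ → ℂ := fun x => (x.1 : ℂ) + (x.2 : ℂ) * Complex.I
  let W' : ℝ × ℝ → ℂ := fun x => (x.1 : ℂ) - (x.2 : ℂ) * Complex.I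
  have hx1 : AnalyticAt ℝ (fun x : ℝ × ℝ => (x.1 : ℂ)) 0 := (hof _).comp analyticAt_fst
  have hx2 : AnalyticAt ℝ (fun x : ℝ × ℝ => (x.2 : ℂ)) 0 := (hof _).comp analyticAt_snd
  have hW : AnalyticAt ℝ W 0 := hx1.add (hx2.mul analyticAt_const)
  have hW' : AnalyticAt ℝ W' 0 := hx1.sub (hx2.mul analyticAt_const)
  have hS : AnalyticAt ℝ (fun x : ℝ × ℝ => H (x.1 ^ 2 + x.2 ^ 2)) 0 := by
    have h1 : AnalyticAt ℝ (fun x : ℝ × ℝ => x.1 ^ 2 + x.2 ^ 2) 0 :=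
      (analyticAt_fst.pow 2).add (analyticAt_snd.pow 2)
    have h2 : AnalyticAt ℝ H ((fun x : ℝ × ℝ => x.1 ^ 2 + x.2 ^ 2) 0) := by simpa using hH
    exact AnalyticAt.comp (g := H) (f := fun x : ℝ × ℝ => x.1 ^ 2 + x.2 ^ 2) h2 h1
  have hG : AnalyticAt ℝ (fun x : ℝ × ℝ => (if 0 ≤ m then W x ^ N else W' x ^ N)
      * H (x.1 ^ 2 + x.2 ^ 2)) 0 := by
    by_cases hm : 0 ≤ m
    · simp only [hm, if_true]; exact (hW.pow N).mul hS
    · simp only [hm, if_false]; exact (hW'.pow N).mul hS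
  refine hG.congr ?_
  have hWt : Tendsto (fun x => ‖W x‖) (𝓝 0) (𝓝 0) := by
    have := hW.continuousAt.norm.tendsto
    simpa [W] using this
  filter_upwards [hWt.eventually hfK, hWt.eventually hKH] with x h1 h2
  obtain ⟨w, hw, hx⟩ := polar (W x)
  have hx' : x = (‖W x‖ * w.re, ‖W x‖ * w.im) := by
    have e1 := congrArg Complex.re hx
    have e2 := congrArg Complex.im hx
    rw [Complex.re_ofReal_mul] at e1
    rw [Complex.im_ofReal_mul] at e2
    rw [← e1, ← e2]
    simp [W]
  have hsq : ‖W x‖ ^ 2 = x.1 ^ 2 + x.2 ^ 2 := by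
    simp only [W, Complex.norm_add_mul_I]
    rw [Real.sq_sqrt (by positivity)]
  have hconj : (starRingEnd ℂ) (W x) = W' x := by simp [W, W', sub_eq_add_neg]
  have hΨx : Ψ x = w ^ m * Ψ (‖W x‖, 0) := by
    rw [← equi_unit hΨ w hw, ← hx']
  rw [hΨx, h1, h2, hsq, ← mul_assoc, unit_pow_mul m w hw, ← hx, hconj]

/-- Theorem 2(ii): with valid conventions at the two-body collision, the external wave
function `Ψ` is real-analytic at the origin iff the internal wave function
`χ(s) = Ψ(𝐫(s))` is real-analytic at `0` with Taylor coefficients of order `n`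
vanishing whenever `n < |m|` or `n ≢ m (mod 2)`, i.e. `χ(s) = Σ_k a_k s^{|m|+2k}`. -/
theorem stmt1 (q : ℝ → ℝ) (hq : AnalyticAt ℝ q 0) (hqodd : ∀ r : ℝ, q (-r) = -q r)
    (hq' : deriv q 0 ≠ 0)
    (rv : ℝ → ℝ × ℝ) (hrv : AnalyticAt ℝ rv (q 0))
    (hrvodd : ∀ s : ℝ, rv (-s) = -rv s)
    (hnorm : ∀ᶠ r in 𝓝 (0 : ℝ), 0 ≤ r → nrm (rv (q r)) = r)
    (m : ℤ) (Ψ : ℝ × ℝ → ℂ) (hΨ : Equivariant m Ψ) :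
    AnalyticAt ℝ Ψ 0 ↔
      (AnalyticAt ℝ (fun s : ℝ => Ψ (rv s)) (q 0) ∧
        ∀ n : ℕ, ((n : ℤ) < |m| ∨ ¬ (2 ∣ (m - n))) →
          iteratedDeriv n (fun s : ℝ => Ψ (rv s)) (q 0) = 0) := by
  have hq0 : q 0 = 0 := by
    have := hqodd 0
    rw [neg_zero] at this
    exact self_eq_neg.1 this
  rw [hq0] at hrv ⊢
  constructor
  · intro ha
    exact forward hΨ ha rv hrv hrvodd
  · rintro ⟨hχ, hd⟩
    exact backward hΨ q hq hqodd rv hrv hrvodd hnorm hχ (fun n hn => hd n (Or.inl hn))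
end

section
/- Let m be an integer and let Ψ : ℝ² → ℂ be equivariant of weight m and real-analytic at the origin. Then the radial restriction χ : ℝ → ℂ defined by χ(t) = Ψ(t, 0) is real-analytic at 0 and satisfies χ^{(n)}(0) = 0 for every nonnegative integer n such that n < |m| or n ≢ m (mod 2). Consequently χ(t) = Σ_{k≥0} a_k t^{|m|+2k} in a neighborhood of 0. -/
open Filter Topology

/-- A homogeneous polynomial on the unit circle is a trigonometric polynomial. -/
lemma exists_poly_circle (n : ℕ) :
    ∀ p : MultilinearMap ℝ (fun _ : Fin n => ℝ × ℝ) ℂ,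
      ∃ P : Polynomial ℂ, P.natDegree ≤ 2 * n ∧ ∀ α : ℝ,
        Complex.exp (α * Complex.I) ^ n * p (fun _ => (Real.cos α, Real.sin α)) =
          P.eval (Complex.exp (α * Complex.I)) := by
  induction n with
  | zero =>
    intro p
    refine ⟨Polynomial.C (p ![]), by simp, fun α => ?_⟩
    simp only [pow_zero, one_mul, Polynomial.eval_C]
    congr 1
    exact Subsingleton.elim _ _
  | succ n ih =>
    intro p
    obtain ⟨P, hPd, hP⟩ := ih (p.curryLeft (1, 0))
    obtain ⟨Q, hQd, hQ⟩ := ih (p.curryLeft (0, 1))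
    refine ⟨Polynomial.C (1 / 2) * (Polynomial.X ^ 2 + 1) * P
      + Polynomial.C (-Complex.I / 2) * (Polynomial.X ^ 2 - 1) * Q, ?_, fun α => ?_⟩
    · have h1 : (Polynomial.C (1 / 2 : ℂ) * (Polynomial.X ^ 2 + 1)).natDegree ≤ 2 := by
        compute_degree
      have h2 : (Polynomial.C (-Complex.I / 2 : ℂ) * (Polynomial.X ^ 2 - 1)).natDegree ≤ 2 := by
        compute_degree
      refine Polynomial.natDegree_add_le_of_degree_le ?_ ?_
      · exact Polynomial.natDegree_mul_le.trans (by omega)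
      · exact Polynomial.natDegree_mul_le.trans (by omega)
    · have hsplit : p (fun _ => (Real.cos α, Real.sin α)) =
          (Real.cos α : ℂ) * p.curryLeft (1, 0) (fun _ => (Real.cos α, Real.sin α)) +
          (Real.sin α : ℂ) * p.curryLeft (0, 1) (fun _ => (Real.cos α, Real.sin α)) := by
        have h1 : p (fun _ => (Real.cos α, Real.sin α)) =
            p.curryLeft (Real.cos α, Real.sin α) (fun _ => (Real.cos α, Real.sin α)) := by
          rw [MultilinearMap.curryLeft_apply]
          congr 1
          funext i
          refine Fin.cases ?_ (fun j => ?_) i <;> simp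
        have h2 : ((Real.cos α, Real.sin α) : ℝ × ℝ) =
            Real.cos α • ((1, 0) : ℝ × ℝ) + Real.sin α • ((0, 1) : ℝ × ℝ) := by simp
        rw [h1]
        conv_lhs => rw [show p.curryLeft (Real.cos α, Real.sin α) =
          Real.cos α • p.curryLeft (1, 0) + Real.sin α • p.curryLeft (0, 1) by
            rw [h2, map_add, map_smul, map_smul]]
        simp
      have hc : Complex.exp (α * Complex.I) * (Real.cos α : ℂ) =
          1 / 2 * (Complex.exp (α * Complex.I) ^ 2 + 1) := by
        have := Complex.cos_sq_add_sin_sq (α : ℂ)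
        rw [Complex.exp_mul_I]; push_cast
        linear_combination (1/2) * this + (-1/2) * Complex.sin α ^ 2 * Complex.I_sq
      have hs : Complex.exp (α * Complex.I) * (Real.sin α : ℂ) =
          -Complex.I / 2 * (Complex.exp (α * Complex.I) ^ 2 - 1) := by
        have := Complex.cos_sq_add_sin_sq (α : ℂ)
        rw [Complex.exp_mul_I]; push_cast
        linear_combination (Complex.I / 2) * this + (Complex.cos α * Complex.sin α +
          Complex.I / 2 * Complex.sin α ^ 2) * Complex.I_sq
      rw [hsplit]
      simp only [Polynomial.eval_add, Polynomial.eval_mul, Polynomial.eval_C, Polynomial.eval_sub,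
        Polynomial.eval_pow, Polynomial.eval_X, Polynomial.eval_one, ← hP α, ← hQ α, ← hc, ← hs]
      ring

lemma infinite_circle : (Set.range fun α : ℝ => Complex.exp (α * Complex.I)).Infinite := by
  have : Set.InjOn (fun α : ℝ => Complex.exp (α * Complex.I)) (Set.Ioc (-Real.pi) Real.pi) := by
    intro a ha b hb h
    have := congrArg Complex.arg h
    simpa [Complex.arg_exp_mul_I, (toIocMod_eq_self Real.two_pi_pos).2,
      show -Real.pi + 2 * Real.pi = Real.pi by ring, ha.1, ha.2, hb.1, hb.2] using this
  refine Set.Infinite.mono (Set.image_subset_range _ (Set.Ioc (-Real.pi) Real.pi)) ?_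
  exact (Set.Ioc_infinite (by linarith [Real.pi_pos])).image this

lemma poly_ext_circle (P Q : Polynomial ℂ)
    (h : ∀ α : ℝ, P.eval (Complex.exp (α * Complex.I)) = Q.eval (Complex.exp (α * Complex.I))) :
    P = Q := by
  apply Polynomial.eq_of_infinite_eval_eq
  refine infinite_circle.mono ?_
  rintro _ ⟨α, rfl⟩
  exact h α

lemma coeff_vanish (m : ℤ) (n : ℕ) (p : MultilinearMap ℝ (fun _ : Fin n => ℝ × ℝ) ℂ) (c : ℂ)
    (h : ∀ α : ℝ, p (fun _ => (Real.cos α, Real.sin α)) =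
      Complex.exp ((m : ℂ) * α * Complex.I) * c)
    (hn : (n : ℤ) < |m| ∨ ¬ (2 ∣ (m - n))) : c = 0 := by
  obtain ⟨P, hPd, hP⟩ := exists_poly_circle n p
  have hz : ∀ α : ℝ, Complex.exp ((m : ℂ) * α * Complex.I) = Complex.exp (α * Complex.I) ^ m := by
    intro α
    rw [← Complex.exp_int_mul]; congr 1; ring
  have hz0 : ∀ α : ℝ, Complex.exp (α * Complex.I) ≠ 0 := fun α => Complex.exp_ne_zero _
  rcases hn with hn | hn
  · rcases le_or_gt 0 m with hm | hm
    · rw [abs_of_nonneg hm] at hn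
      obtain ⟨k, rfl⟩ := Int.eq_ofNat_of_zero_le hm
      have : P = Polynomial.C c * Polynomial.X ^ (n + k) := by
        apply poly_ext_circle
        intro α
        rw [← hP, h, hz]
        simp [pow_add]; ring
      have h2 : P.coeff (n + k) = 0 := Polynomial.coeff_eq_zero_of_natDegree_lt (by omega)
      rw [this] at h2
      simpa using h2
    · rw [abs_of_neg hm] at hn
      obtain ⟨k, hk⟩ : ∃ k : ℕ, -m = n + (k + 1) := ⟨(-m - n - 1).toNat, by omega⟩
      have : P * Polynomial.X ^ (k + 1) = Polynomial.C c := by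
        apply poly_ext_circle
        intro α
        have e : m = -((n + (k + 1) : ℕ) : ℤ) := by push_cast; omega
        rw [Polynomial.eval_mul, ← hP, h, hz, e, zpow_neg, zpow_natCast, pow_add]
        have := hz0 α
        simp
        field_simp
      have h2 := congrArg (fun R => Polynomial.eval 0 R) this
      simpa using h2.symm
  · have h0 := h Real.pi
    have h1 := h 0
    have e : (fun _ : Fin n => ((Real.cos Real.pi, Real.sin Real.pi) : ℝ × ℝ)) =
        fun i => (fun _ => (-1 : ℝ)) i • (fun _ : Fin n => ((1, 0) : ℝ × ℝ)) i := by
      funext i; simp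
    rw [e, MultilinearMap.map_smul_univ] at h0
    simp only [Real.cos_zero, Real.sin_zero] at h1
    rw [h1, hz Real.pi, Complex.exp_pi_mul_I] at h0
    simp at h0
    rcases Int.even_or_odd m with hm | hm <;> rcases Nat.even_or_odd n with hn' | hn'
    · exfalso; apply hn; obtain ⟨a, ha⟩ := hm; obtain ⟨b, hb⟩ := hn'; omega
    · rw [hm.neg_one_zpow, hn'.neg_one_pow] at h0
      exact h0.resolve_left (by norm_num)
    · rw [hm.neg_one_zpow, hn'.neg_one_pow] at h0
      exact h0.resolve_left (by norm_num)
    · exfalso; apply hn; obtain ⟨a, ha⟩ := hm; obtain ⟨b, hb⟩ := hn'; omega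

/-- Forward direction of Theorem 2(ii) in the standard convention: the radial
restriction `χ(t) = Ψ(t,0)` of an equivariant analytic wave function is analytic at `0`,
its derivatives of order `n` vanish at `0` when `n < |m|` or `n ≢ m (mod 2)`, and
consequently `χ(t) = Σ_k a_k t^{|m|+2k}` near `0`. -/
theorem stmt2 (m : ℤ) (Ψ : ℝ × ℝ → ℂ) (hΨ : Equivariant m Ψ)
    (hA : AnalyticAt ℝ Ψ 0) :
    AnalyticAt ℝ (fun t : ℝ => Ψ (t, 0)) 0 ∧
    (∀ n : ℕ, ((n : ℤ) < |m| ∨ ¬ (2 ∣ (m - n))) →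
      iteratedDeriv n (fun t : ℝ => Ψ (t, 0)) 0 = 0) ∧
    ∃ a : ℕ → ℂ, ∀ᶠ t in 𝓝 (0 : ℝ),
      HasSum (fun k : ℕ => a k * (Complex.ofReal t) ^ (m.natAbs + 2 * k)) (Ψ (t, 0)) := by
  obtain ⟨p, hp⟩ := hA
  let L : ℝ → (ℝ →L[ℝ] ℝ × ℝ) := fun α =>
    ContinuousLinearMap.toSpanSingleton ℝ ((Real.cos α, Real.sin α) : ℝ × ℝ)
  have hL : ∀ α, HasFPowerSeriesAt (Ψ ∘ L α) (p.compContinuousLinearMap (L α)) 0 := by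
    intro α
    apply HasFPowerSeriesAt.compContinuousLinearMap
    rwa [map_zero]
  have hχ : Ψ ∘ L 0 = fun t : ℝ => Ψ (t, 0) := by
    funext t; simp [L]
  have h0 := hL 0
  rw [hχ] at h0
  set q := p.compContinuousLinearMap (L 0) with hq
  have hrot : ∀ α, Ψ ∘ L α =
      Complex.exp ((m : ℂ) * α * Complex.I) • (fun t : ℝ => Ψ (t, 0)) := by
    intro α; funext t
    have := hΨ α (t, 0)
    simp only [Pi.smul_apply, smul_eq_mul, ← this]
    simp [L, rot, mul_comm]
  have hv : ∀ n : ℕ, ((n : ℤ) < |m| ∨ ¬ (2 ∣ (m - n))) → q.coeff n = 0 := by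
    intro n hn
    refine coeff_vanish m n (p n).toMultilinearMap _ (fun α => ?_) hn
    have h1 := hL α
    rw [hrot α] at h1
    have h2 := h1.eq_formalMultilinearSeries
      (h0.const_smul (c := Complex.exp ((m : ℂ) * α * Complex.I)))
    have h3 := congrArg (fun s : FormalMultilinearSeries ℝ ℝ ℂ => s n (fun _ => 1)) h2
    have h4 : (p.compContinuousLinearMap (L α)) n (fun _ => 1) =
        p n (fun _ => (Real.cos α, Real.sin α)) := by
      rw [FormalMultilinearSeries.compContinuousLinearMap_apply]
      congr 1
      funext i; simp [L]
    exact h4.symm.trans h3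
  refine ⟨⟨q, h0⟩, fun n hn => ?_, fun k => q.coeff (m.natAbs + 2 * k), ?_⟩
  · obtain ⟨r, hr⟩ := h0
    rw [iteratedDeriv_eq_iteratedFDeriv, ← hr.factorial_smul]
    have : q n (fun _ => (1 : ℝ)) = q.coeff n := rfl
    rw [this, hv n hn, smul_zero]
  · filter_upwards [hasFPowerSeriesAt_iff.1 h0] with t ht
    rw [zero_add] at ht
    have hinj : Function.Injective (fun k : ℕ => m.natAbs + 2 * k) := fun a b h => by
      simp only at h; omega
    rw [← hinj.hasSum_iff] at ht
    · have he : (fun k : ℕ => q.coeff (m.natAbs + 2 * k) * (t : ℂ) ^ (m.natAbs + 2 * k)) =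
          (fun n => t ^ n • q.coeff n) ∘ fun k => m.natAbs + 2 * k := by
        funext k
        simp [mul_comm]
      rw [he]
      exact ht
    · intro n hn
      rw [hv n, smul_zero]
      by_contra hcon
      push Not at hcon
      apply hn
      obtain ⟨h1, j, hj⟩ := hcon
      refine ⟨(n - m.natAbs) / 2, ?_⟩
      simp only
      have := Int.natCast_natAbs m
      omega
end

section
/- Let m be an integer and let χ : ℝ → ℂ be real-analytic at 0 with Taylor expansion χ(t) = Σ_{k≥0} a_k t^{|m|+2k} valid near 0 (i.e., all Taylor coefficients of order n vanish unless n ≥ |m| and n ≡ m (mod 2)). Then there exists a function Ψ : ℝ² → ℂ, real-analytic at the origin, which is equivariant of weight m on a rotation-invariant neighborhood of the origin (Ψ(R_α x) = e^{i m α} Ψ(x) there) and satisfies Ψ(t, 0) = χ(t) for all t in a neighborhood of 0. -/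
open Filter Topology

lemma stmt3_aux (M : ℕ) (χ : ℝ → ℂ) (hχ : AnalyticAt ℝ χ 0)
    (hcoef : ∀ n : ℕ, (¬ ∃ k, M + 2 * k = n) → iteratedDeriv n χ 0 = 0) :
    ∃ g : ℝ → ℂ, AnalyticAt ℝ g 0 ∧ ∀ᶠ t : ℝ in 𝓝 (0 : ℝ), (t : ℂ) ^ M * g (t ^ 2) = χ t := by
  obtain ⟨q, hq⟩ := hχ
  have hq0 : ∀ n : ℕ, (¬ ∃ k, M + 2 * k = n) → q.coeff n = 0 := by
    intro n hn
    obtain ⟨r, hr⟩ := hq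
    have h := hr.factorial_smul 1 n
    rw [← iteratedDeriv_eq_iteratedFDeriv, hcoef n hn] at h
    have h2 : (n.factorial : ℕ) • q.coeff n = 0 := h
    rcases smul_eq_zero.1 h2 with h3 | h3
    · exact absurd h3 n.factorial_ne_zero
    · exact h3
  let p : FormalMultilinearSeries ℝ ℝ ℂ :=
    fun k => ContinuousMultilinearMap.mkPiRing ℝ (Fin k) (q.coeff (M + 2 * k))
  have hp : 0 < p.radius := by
    obtain ⟨r, hr0, hr⟩ := ENNReal.lt_iff_exists_nnreal_btwn.1 hq.radius_pos
    obtain ⟨C, hC, hb⟩ := q.norm_mul_pow_le_of_lt_radius hr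
    have hr0' : 0 < r := by exact_mod_cast hr0
    have hr1 : (0 : ℝ) < r := by exact_mod_cast hr0'
    refine lt_of_lt_of_le ?_ (p.le_radius_of_bound (r := r ^ 2) (C / (r : ℝ) ^ M) ?_)
    · exact_mod_cast pow_pos hr0' 2
    · intro k
      have := hb (M + 2 * k)
      rw [le_div_iff₀ (by positivity)]
      simp only [p, ContinuousMultilinearMap.norm_mkPiRing]
      rw [FormalMultilinearSeries.norm_apply_eq_norm_coef] at this
      calc _ = ‖q.coeff (M + 2 * k)‖ * (r : ℝ) ^ (M + 2 * k) := by push_cast; ring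
        _ ≤ C := this
  have hg := p.hasFPowerSeriesOnBall hp
  refine ⟨p.sum, hg.analyticAt, ?_⟩
  have h1 := hasFPowerSeriesAt_iff.1 hq
  have h2 := hasFPowerSeriesAt_iff.1 hg.hasFPowerSeriesAt
  have ht : Tendsto (fun t : ℝ => t ^ 2) (𝓝 0) (𝓝 0) := by
    have : Continuous (fun t : ℝ => t ^ 2) := by fun_prop
    simpa using this.tendsto 0
  filter_upwards [h1, ht.eventually h2] with t h1 h2
  have hinj : Function.Injective (fun k : ℕ => M + 2 * k) := by
    intro a b h
    simp only at h
    omega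
  rw [← hinj.hasSum_iff] at h1
  · have h3 := h2.mul_left ((t : ℂ) ^ M)
    simp only [zero_add] at h1 h3
    refine h3.unique ?_
    have hpq : ∀ k, p.coeff k = q.coeff (M + 2 * k) := by
      intro k
      change ContinuousMultilinearMap.mkPiRing ℝ (Fin k) (q.coeff (M + 2 * k)) 1 = _
      rw [ContinuousMultilinearMap.mkPiRing_apply]
      simp
    have hfun : (fun k => (t : ℂ) ^ M * ((t ^ 2) ^ k • p.coeff k))
        = (fun n => t ^ n • q.coeff n) ∘ (fun k : ℕ => M + 2 * k) := by
      funext k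
      simp only [Function.comp, hpq, Complex.real_smul]
      push_cast
      ring
    rw [hfun]
    exact h1
  · intro n hn
    rw [hq0 n (by simpa using hn), smul_zero]

/-- Converse direction of Theorem 2(ii) in the standard convention: if `χ` is analytic
at `0` with Taylor expansion `χ(t) = Σ_k a_k t^{|m|+2k}` (all Taylor coefficients of
order `n` vanish unless `n ≥ |m|` and `n ≡ m (mod 2)`), then `χ` extends to a function
`Ψ : ℝ² → ℂ`, analytic at the origin, equivariant of weight `m` on a rotation-invariant
neighborhood of the origin, with `Ψ(t,0) = χ(t)` near `0`. -/
theorem stmt3 (m : ℤ) (χ : ℝ → ℂ) (hχ : AnalyticAt ℝ χ 0)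
    (hcoef : ∀ n : ℕ, ((n : ℤ) < |m| ∨ ¬ (2 ∣ (m - n))) → iteratedDeriv n χ 0 = 0) :
    ∃ Ψ : ℝ × ℝ → ℂ, AnalyticAt ℝ Ψ 0 ∧
      ∃ U : Set (ℝ × ℝ), IsOpen U ∧ (0 : ℝ × ℝ) ∈ U ∧
        (∀ (α : ℝ), ∀ x ∈ U, rot α x ∈ U) ∧
        (∀ (α : ℝ), ∀ x ∈ U, Ψ (rot α x) = Complex.exp ((m : ℂ) * α * Complex.I) * Ψ x) ∧
        ∀ᶠ t in 𝓝 (0 : ℝ), Ψ (t, 0) = χ t := by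
  obtain ⟨g, hg, hgχ⟩ := stmt3_aux m.natAbs χ hχ (by
    intro n hn
    apply hcoef
    by_contra! h
    apply hn
    refine ⟨(n - m.natAbs) / 2, ?_⟩
    rw [Int.abs_eq_natAbs] at h
    omega)
  -- the sign of `m`
  obtain ⟨e, he, hm⟩ : ∃ e : ℝ, e ^ 2 = 1 ∧ (m : ℂ) = m.natAbs * e := by
    rcases Int.natAbs_eq m with h | h
    · refine ⟨1, by norm_num, ?_⟩
      conv_lhs => rw [h]
      simp
    · refine ⟨-1, by norm_num, ?_⟩
      conv_lhs => rw [h]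
      simp
  have hexp : ∀ α : ℝ, Complex.exp ((e : ℂ) * α * Complex.I)
      = Real.cos α + e * Real.sin α * Complex.I := by
    intro α
    have : e = 1 ∨ e = -1 := by simpa using he
    rcases this with h | h
    · subst h; simp [Complex.exp_mul_I]
    · subst h; rw [Complex.exp_mul_I]; simp [neg_one_mul]
  have he' : (e : ℂ) ^ 2 = 1 := by exact_mod_cast he
  refine ⟨fun x => ((x.1 : ℂ) + e * x.2 * Complex.I) ^ m.natAbs * g (x.1 ^ 2 + x.2 ^ 2),
    ?_, Set.univ, isOpen_univ, trivial, fun _ _ _ => trivial, ?_, ?_⟩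
  · have a1 : AnalyticAt ℝ (fun x : ℝ × ℝ => (x.1 : ℂ)) 0 :=
      (Complex.ofRealCLM.comp (ContinuousLinearMap.fst ℝ ℝ ℝ)).analyticAt 0
    have a2 : AnalyticAt ℝ (fun x : ℝ × ℝ => (x.2 : ℂ)) 0 :=
      (Complex.ofRealCLM.comp (ContinuousLinearMap.snd ℝ ℝ ℝ)).analyticAt 0
    have a3 : AnalyticAt ℝ (fun x : ℝ × ℝ => x.1 ^ 2 + x.2 ^ 2) 0 :=
      (analyticAt_fst.pow 2).add (analyticAt_snd.pow 2)
    refine ((a1.add ((analyticAt_const.mul a2).mul analyticAt_const)).pow _).mul ?_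
    exact AnalyticAt.fun_comp (g := g) (by simpa using hg) a3
  · intro α x _
    have e1 : (m : ℂ) * α * Complex.I = m.natAbs * ((e : ℂ) * α * Complex.I) := by
      rw [hm]; ring
    have e2 : (rot α x).1 ^ 2 + (rot α x).2 ^ 2 = x.1 ^ 2 + x.2 ^ 2 := by
      simp only [rot]
      linear_combination (x.1 ^ 2 + x.2 ^ 2) * Real.sin_sq_add_cos_sq α
    have e3 : ((rot α x).1 : ℂ) + e * (rot α x).2 * Complex.I
        = (Real.cos α + e * Real.sin α * Complex.I) * (x.1 + e * x.2 * Complex.I) := by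
      simp only [rot]
      push_cast
      linear_combination (-(e : ℂ) ^ 2 * Complex.sin α * x.2) * Complex.I_sq
        + (Complex.sin α * x.2) * he'
    simp only [e2, e3]
    rw [e1, Complex.exp_nat_mul, hexp, mul_pow]
    ring
  · filter_upwards [hgχ] with t ht
    simpa using ht
end

section
/- Let f : ℝ → ℂ be real-analytic at 0 and even (f(−r) = f(r) for all r near 0). Then the function F : ℝ² → ℂ defined by F(x, y) = f(√(x² + y²)) is real-analytic at the origin of ℝ². -/
open Filter Topology

/-- First special case of Theorem 2: if `f : ℝ → ℂ` is analytic at `0` and even near `0`,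
then `F(x,y) = f(√(x²+y²))` is a real-analytic function of the Cartesian coordinates
at the origin of the plane. -/
theorem stmt5 (f : ℝ → ℂ) (hf : AnalyticAt ℝ f 0)
    (heven : ∀ᶠ r in 𝓝 (0 : ℝ), f (-r) = f r) :
    AnalyticAt ℝ (fun x : ℝ × ℝ => f (Real.sqrt (x.1 ^ 2 + x.2 ^ 2))) 0 := by
  obtain ⟨p, hp⟩ := hf
  rw [hasFPowerSeriesAt_iff] at hp
  have hneg : Tendsto (fun z : ℝ => -z) (𝓝 0) (𝓝 0) := by
    simpa using (continuous_neg (G := ℝ)).tendsto 0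
  have key : ∀ᶠ z in 𝓝 (0 : ℝ),
      HasSum (fun k : ℕ => z ^ (2 * k) • p.coeff (2 * k)) (f z) := by
    filter_upwards [hp, hneg.eventually hp, heven] with z h1 h2 h3
    simp only [zero_add] at h1 h2
    rw [h3] at h2
    have h4 := (h1.add h2).const_smul (1 / 2 : ℝ)
    have h5 : (1 / 2 : ℝ) • (f z + f z) = f z := by
      rw [← two_smul ℝ (f z), smul_smul]; norm_num
    rw [h5] at h4
    have hinj : Function.Injective (fun k : ℕ => 2 * k) := fun a b h => by
      simpa using h
    rw [← hinj.hasSum_iff] at h4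
    · refine h4.congr_fun ?_ 
      intro k
      simp only [Function.comp]
      rw [(even_two_mul k).neg_pow, ← two_smul ℝ (z ^ (2 * k) • _), smul_smul]; norm_num
    · intro n hn
      have hodd : Odd n := by
        rw [← Nat.not_even_iff_odd]
        rintro ⟨k, rfl⟩
        exact hn ⟨k, by simp only; ring⟩
      rw [hodd.neg_pow]; simp
  have hsq : Tendsto (fun t : ℝ => Real.sqrt |t|) (𝓝 0) (𝓝 0) := by
    have : Continuous (fun t : ℝ => Real.sqrt |t|) := by fun_prop
    simpa using this.tendsto 0
  have hg : AnalyticAt ℝ (fun t : ℝ => ∑' k : ℕ, t ^ k • p.coeff (2 * k)) 0 := by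
    let q : FormalMultilinearSeries ℝ ℝ ℂ :=
      fun k => ContinuousMultilinearMap.mkPiRing ℝ (Fin k) (p.coeff (2 * k))
    have hqc : ∀ k, q.coeff k = p.coeff (2 * k) := by
      intro k
      change ContinuousMultilinearMap.mkPiRing ℝ (Fin k) (p.coeff (2 * k)) 1 = _
      rw [ContinuousMultilinearMap.mkPiRing_apply]
      simp only [Pi.one_apply, Finset.prod_const_one, one_smul]
    refine ⟨q, hasFPowerSeriesAt_iff.2 ?_⟩
    filter_upwards [hsq.eventually key] with t ht
    have hs : Summable (fun k : ℕ => t ^ k • p.coeff (2 * k)) := by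
      refine Summable.of_norm ?_
      refine ht.summable.norm.congr ?_
      intro k
      rw [norm_smul, norm_smul, pow_mul, Real.sq_sqrt (abs_nonneg t)]
      simp
    simp only [hqc, zero_add]
    exact hs.hasSum
  have hq : AnalyticAt ℝ (fun x : ℝ × ℝ => x.1 ^ 2 + x.2 ^ 2) 0 :=
    (analyticAt_fst.pow 2).add (analyticAt_snd.pow 2)
  have hcomp : AnalyticAt ℝ (fun x : ℝ × ℝ =>
      ∑' k : ℕ, (x.1 ^ 2 + x.2 ^ 2) ^ k • p.coeff (2 * k)) 0 :=
    AnalyticAt.fun_comp (g := fun t : ℝ => ∑' k : ℕ, t ^ k • p.coeff (2 * k))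
      (f := fun x : ℝ × ℝ => x.1 ^ 2 + x.2 ^ 2) (by
        have h0 : (0 : ℝ × ℝ).1 ^ 2 + (0 : ℝ × ℝ).2 ^ 2 = 0 := by simp
        rw [h0]; exact hg) hq
  refine hcomp.congr ?_
  have hs2 : Tendsto (fun x : ℝ × ℝ => Real.sqrt (x.1 ^ 2 + x.2 ^ 2)) (𝓝 0) (𝓝 0) := by
    have : Continuous (fun x : ℝ × ℝ => Real.sqrt (x.1 ^ 2 + x.2 ^ 2)) := by fun_prop
    simpa using this.tendsto 0
  filter_upwards [hs2.eventually key] with x hx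
  rw [← hx.tsum_eq]
  refine tsum_congr fun k => ?_
  rw [pow_mul, Real.sq_sqrt (by positivity)]
end

section
/- Let f : ℝ → ℂ be real-analytic at 0 and odd (f(−r) = −f(r) for all r near 0). Then the function F : ℝ² → ℂ defined by F(x, y) = ((x + i y)/√(x² + y²)) · f(√(x² + y²)) for (x, y) ≠ (0,0) and F(0,0) = 0 is real-analytic at the origin of ℝ². -/
open Filter Topology

/-- An odd analytic function is `z • G (z ^ 2)` with `G` analytic. -/
theorem odd_factor (f : ℝ → ℂ) (hf : AnalyticAt ℝ f 0)
    (hodd : ∀ᶠ r in 𝓝 (0 : ℝ), f (-r) = -f r) :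
    ∃ G : ℝ → ℂ, AnalyticAt ℝ G 0 ∧ ∀ᶠ z in 𝓝 (0 : ℝ), f z = z • G (z ^ 2) := by
  obtain ⟨p, hp⟩ := hf
  rw [hasFPowerSeriesAt_iff] at hp
  simp only [zero_add] at hp
  set a : ℕ → ℂ := fun n => p.coeff n with ha
  have hinj : Function.Injective (fun k : ℕ => 2 * k + 1) := by
    intro i j h
    simp only at h
    omega
  have hsq : Tendsto (fun t : ℝ => Real.sqrt |t|) (𝓝 0) (𝓝 0) := by
    have : Continuous (fun t : ℝ => Real.sqrt |t|) := by fun_prop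
    simpa using this.tendsto 0
  have hsum : ∀ᶠ t in 𝓝 (0 : ℝ), Summable (fun k => t ^ k • a (2 * k + 1)) := by
    filter_upwards [hsq.eventually hp] with t ht
    rcases eq_or_ne t 0 with rfl | h0
    · exact (HasSum.hasSum_at_zero (𝕜 := ℝ) (fun k => a (2 * k + 1))).summable
    · have hpos : 0 < Real.sqrt |t| := Real.sqrt_pos.2 (abs_pos.2 h0)
      have h1 := (ht.summable.norm.comp_injective hinj).mul_left (Real.sqrt |t|)⁻¹
      refine Summable.of_norm (h1.congr fun k => ?_)
      simp only [Function.comp, norm_smul, norm_pow, Real.norm_eq_abs, abs_of_pos hpos]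
      rw [pow_succ, pow_mul, Real.sq_sqrt (abs_nonneg t)]
      field_simp
      rfl
  refine ⟨fun t => ∑' k, t ^ k • a (2 * k + 1), ?_, ?_⟩
  · let q : FormalMultilinearSeries ℝ ℝ ℂ :=
      fun k => ContinuousMultilinearMap.mkPiRing ℝ (Fin k) (a (2 * k + 1))
    have hq : ∀ k, q.coeff k = a (2 * k + 1) := by
      intro k
      simp [q, FormalMultilinearSeries.coeff]
    refine ⟨q, hasFPowerSeriesAt_iff.2 ?_⟩
    filter_upwards [hsum] with t ht
    simpa only [hq, zero_add] using ht.hasSum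
  · have hneg : Tendsto (fun t : ℝ => -t) (𝓝 0) (𝓝 0) := by
      simpa using (continuous_neg (G := ℝ)).tendsto 0
    have hsq2 : Tendsto (fun t : ℝ => t ^ 2) (𝓝 0) (𝓝 0) := by
      simpa using (continuous_pow (M := ℝ) 2).tendsto 0
    filter_upwards [hp, hneg.eventually hp, hodd, hsq2.eventually hsum] with z h1 h2 h3 h4
    rw [h3] at h2
    have h5 := h1.sub h2
    rw [← hinj.hasSum_iff] at h5
    · have h6 := h4.hasSum.const_smul (2 * z)
      have h7 := h5.unique (h6.congr_fun ?_)
      · rw [mul_smul] at h7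
        have : (2 : ℝ) • f z = (2 : ℝ) • (z • ∑' k, (z ^ 2) ^ k • a (2 * k + 1)) := by
          rw [← h7, two_smul]; ring
        exact smul_right_injective ℂ (two_ne_zero (α := ℝ)) this
      · intro k
        simp only [Function.comp, Odd.neg_pow (odd_two_mul_add_one k), smul_smul, ← sub_smul]
        congr 1
        ring
    · intro n hn
      have : Even n := by
        rw [← Nat.not_odd_iff_even]
        rintro ⟨k, hk⟩
        exact hn ⟨k, hk.symm⟩
      simp [this.neg_pow]

/-- Second special case of Theorem 2: if `f : ℝ → ℂ` is analytic at `0` and odd near `0`,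
then the function `F = e^{iθ} f(r)` of the standard polar coordinates, i.e.
`F(x,y) = ((x+iy)/√(x²+y²)) f(√(x²+y²))` for `(x,y) ≠ 0` and `F(0,0) = 0`,
is a real-analytic function of the Cartesian coordinates at the origin of the plane. -/
theorem stmt6 (f : ℝ → ℂ) (hf : AnalyticAt ℝ f 0)
    (hodd : ∀ᶠ r in 𝓝 (0 : ℝ), f (-r) = -f r)
    (F : ℝ × ℝ → ℂ) (hF0 : F 0 = 0)
    (hF : ∀ x : ℝ × ℝ, x ≠ 0 →
      F x = (Complex.ofReal x.1 + Complex.ofReal x.2 * Complex.I) /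
              Complex.ofReal (Real.sqrt (x.1 ^ 2 + x.2 ^ 2)) *
            f (Real.sqrt (x.1 ^ 2 + x.2 ^ 2))) :
    AnalyticAt ℝ F 0 := by
  obtain ⟨G, hG, hfG⟩ := odd_factor f hf hodd
  have hfst : AnalyticAt ℝ (fun x : ℝ × ℝ => x.1) 0 := analyticAt_fst
  have hsnd : AnalyticAt ℝ (fun x : ℝ × ℝ => x.2) 0 := analyticAt_snd
  have hq : AnalyticAt ℝ (fun x : ℝ × ℝ => x.1 ^ 2 + x.2 ^ 2) 0 := (hfst.pow 2).add (hsnd.pow 2)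
  have hGq : AnalyticAt ℝ (fun x : ℝ × ℝ => G (x.1 ^ 2 + x.2 ^ 2)) 0 :=
    AnalyticAt.fun_comp (g := G) (by simpa using hG) hq
  have h1 : AnalyticAt ℝ (fun x : ℝ × ℝ => (x.1 : ℂ)) 0 :=
    (Complex.ofRealCLM.analyticAt _).fun_comp hfst
  have h2 : AnalyticAt ℝ (fun x : ℝ × ℝ => (x.2 : ℂ)) 0 :=
    (Complex.ofRealCLM.analyticAt _).fun_comp hsnd
  have hH := (h1.add (h2.mul (analyticAt_const (v := Complex.I)))).mul hGq
  refine hH.congr ?_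
  have ht : Tendsto (fun x : ℝ × ℝ => Real.sqrt (x.1 ^ 2 + x.2 ^ 2)) (𝓝 0) (𝓝 0) := by
    have : Continuous (fun x : ℝ × ℝ => Real.sqrt (x.1 ^ 2 + x.2 ^ 2)) := by fun_prop
    simpa using this.tendsto 0
  filter_upwards [ht.eventually hfG] with x hx
  rcases eq_or_ne x 0 with rfl | h0
  · simp [hF0]
  · have hpos : 0 < x.1 ^ 2 + x.2 ^ 2 := by
      by_contra hc
      apply h0
      have e1 : x.1 = 0 := by nlinarith [sq_nonneg x.1, sq_nonneg x.2]
      have e2 : x.2 = 0 := by nlinarith [sq_nonneg x.1, sq_nonneg x.2]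
      exact Prod.ext e1 e2
    have hr : (Complex.ofReal (Real.sqrt (x.1 ^ 2 + x.2 ^ 2))) ≠ 0 :=
      Complex.ofReal_ne_zero.2 (Real.sqrt_pos.2 hpos).ne'
    rw [hF x h0, hx, Real.sq_sqrt hpos.le, Complex.real_smul, ← mul_assoc, div_mul_cancel₀ _ hr]
    rfl
end

section
/- Let m be an integer and let Ψ : ℝ² → ℂ be equivariant of weight m and infinitely differentiable on a neighborhood of the origin. Then for every nonnegative integer d with d < |m| or d ≢ m (mod 2), the d-th iterated (Fréchet) derivative of Ψ at the origin vanishes identically: (∂^d Ψ/∂x_{j_1}⋯∂x_{j_d})(0) = 0 for all indices j_1, …, j_d ∈ {1, 2}. -/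
open Filter Topology

noncomputable def rotEquiv (α : ℝ) : (ℝ × ℝ) ≃L[ℝ] (ℝ × ℝ) :=
  LinearEquiv.toContinuousLinearEquiv
    { toFun := rot α
      invFun := rot (-α)
      map_add' := by intro x y; ext <;> simp [rot] <;> ring
      map_smul' := by intro c x; ext <;> simp [rot] <;> ring
      left_inv := by
        intro x
        have h := Real.sin_sq_add_cos_sq α
        ext <;> simp [rot]
        · linear_combination x.1 * h
        · linear_combination x.2 * h
      right_inv := by
        intro x
        have h := Real.sin_sq_add_cos_sq α
        ext <;> simp [rot]
        · linear_combination x.1 * h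
        · linear_combination x.2 * h }

lemma rotEquiv_apply (α : ℝ) (x : ℝ × ℝ) : rotEquiv α x = rot α x := rfl

lemma rot_split (α : ℝ) (T : (ℝ × ℝ) →ₗ[ℝ] ℂ) (ε : ℂ) (hε : ε ^ 2 = -1) :
    T (rot α (1, 0)) + ε * T (rot α (0, 1)) =
      (Real.cos α - ε * Real.sin α) * (T (1, 0) + ε * T (0, 1)) := by
  have h1 : rot α (1, 0) = Real.cos α • ((1, 0) : ℝ × ℝ) + Real.sin α • ((0, 1) : ℝ × ℝ) := by
    simp [rot]
  have h2 : rot α (0, 1) = (-Real.sin α) • ((1, 0) : ℝ × ℝ) + Real.cos α • ((0, 1) : ℝ × ℝ) := by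
    simp [rot]
  rw [h1, h2]
  simp only [map_add, map_smul, Complex.real_smul]
  push_cast
  linear_combination Complex.sin α * T (0, 1) * hε

/-- Contracting the first slot with `e₁ + ε e₂`. -/
noncomputable def contr {d : ℕ} (ε : ℂ) (T : MultilinearMap ℝ (fun _ : Fin (d + 1) => ℝ × ℝ) ℂ) :
    MultilinearMap ℝ (fun _ : Fin d => ℝ × ℝ) ℂ :=
  T.curryLeft (1, 0) + ε • T.curryLeft (0, 1)

lemma contr_equiv {d : ℕ} (ε : ℂ) (hε : ε ^ 2 = -1) (m k : ℤ)
    (hk : ∀ α : ℝ, (Real.cos α - ε * Real.sin α) * Complex.exp ((k : ℂ) * α * Complex.I)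
      = Complex.exp ((m : ℂ) * α * Complex.I))
    (T : MultilinearMap ℝ (fun _ : Fin (d + 1) => ℝ × ℝ) ℂ)
    (hT : ∀ (α : ℝ) v, T (fun i => rot α (v i)) = Complex.exp ((m : ℂ) * α * Complex.I) * T v)
    (α : ℝ) (v : Fin d → ℝ × ℝ) :
    contr ε T (fun i => rot α (v i)) = Complex.exp ((k : ℂ) * α * Complex.I) * contr ε T v := by
  have hc : ∀ x : ℝ × ℝ, T (Fin.cons (rot α x) (fun i => rot α (v i)))
      = Complex.exp ((m : ℂ) * α * Complex.I) * T (Fin.cons x v) := by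
    intro x
    rw [← hT]
    congr 1
    funext i
    refine Fin.cases ?_ (fun j => ?_) i <;> simp
  let L : (ℝ × ℝ) →ₗ[ℝ] ℂ :=
    { toFun := fun x => T (Fin.cons x (fun i => rot α (v i)))
      map_add' := fun x y => T.cons_add _ x y
      map_smul' := fun c x => T.cons_smul _ c x }
  have h := rot_split α L ε hε
  simp only [L, LinearMap.coe_mk, AddHom.coe_mk, hc] at h
  have hne : (Real.cos α - ε * Real.sin α : ℂ) ≠ 0 := by
    intro h0
    have := hk α
    rw [h0, zero_mul] at this
    exact Complex.exp_ne_zero _ this.symm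
  apply mul_left_cancel₀ hne
  simp only [contr, MultilinearMap.add_apply, MultilinearMap.smul_apply,
    MultilinearMap.curryLeft_apply, smul_eq_mul]
  rw [← h]
  linear_combination -(T (Fin.cons (1, 0) v) + ε * T (Fin.cons (0, 1) v)) * hk α

lemma multilinear_zero (d : ℕ) : ∀ (m : ℤ), ((d : ℤ) < |m| ∨ ¬ (2 ∣ (m - d))) →
    ∀ (T : MultilinearMap ℝ (fun _ : Fin d => ℝ × ℝ) ℂ),
    (∀ (α : ℝ) v, T (fun i => rot α (v i)) = Complex.exp ((m : ℂ) * α * Complex.I) * T v) →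
    T = 0 := by
  induction d with
  | zero =>
    intro m hm T hT
    have hm0 : m ≠ 0 := by
      rintro rfl
      simp at hm
    ext v
    have h := hT (Real.pi / m) v
    have hv : (fun i => rot (Real.pi / m) (v i)) = v := Subsingleton.elim _ _
    have hmc : (m : ℂ) ≠ 0 := by exact_mod_cast hm0
    have he : (m : ℂ) * ((Real.pi / m : ℝ) : ℂ) * Complex.I = Real.pi * Complex.I := by
      push_cast
      field_simp
    rw [hv, he, Complex.exp_pi_mul_I] at h
    simp only [MultilinearMap.zero_apply]
    linear_combination h / 2
  | succ d ih =>
    intro m hm T hT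
    have hI : Complex.I ^ 2 = -1 := Complex.I_sq
    have hp : contr Complex.I T = 0 := by
      apply ih (m + 1) (by push_cast at hm; rcases hm with hm | hm; · left; grind
                           · right; omega)
      apply contr_equiv _ hI m _ _ T hT
      intro α
      have : (Real.cos α - Complex.I * Real.sin α : ℂ) = Complex.exp (-α * Complex.I) := by
        rw [Complex.exp_mul_I, Complex.cos_neg, Complex.sin_neg]; push_cast; ring
      rw [this, ← Complex.exp_add]
      congr 1; push_cast; ring
    have hq : contr (-Complex.I) T = 0 := by
      apply ih (m - 1) (by push_cast at hm; rcases hm with hm | hm; · left; grind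
                           · right; omega)
      apply contr_equiv _ (by simp) m _ _ T hT
      intro α
      have : (Real.cos α - -Complex.I * Real.sin α : ℂ) = Complex.exp (α * Complex.I) := by
        rw [Complex.exp_mul_I]; push_cast; ring
      rw [this, ← Complex.exp_add]
      congr 1; push_cast; ring
    have key : ∀ v, T (Fin.cons (1, 0) v) = 0 ∧ T (Fin.cons (0, 1) v) = 0 := by
      intro v
      have h1 := congrArg (fun S => S v) hp
      have h2 := congrArg (fun S => S v) hq
      simp only [contr, MultilinearMap.add_apply, MultilinearMap.smul_apply,
        MultilinearMap.curryLeft_apply, smul_eq_mul, MultilinearMap.zero_apply] at h1 h2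
      constructor
      · linear_combination (h1 + h2) / 2
      · linear_combination (-Complex.I / 2) * (h1 - h2) + T (Fin.cons (0, 1) v) * hI
    ext v
    have hv : v = Fin.cons ((v 0).1 • ((1, 0) : ℝ × ℝ) + (v 0).2 • ((0, 1) : ℝ × ℝ))
        (Fin.tail v) := by
      conv_lhs => rw [← Fin.cons_self_tail v]
      congr 1
      simp
    rw [hv, T.cons_add, T.cons_smul, T.cons_smul, (key _).1, (key _).2]
    simp

/-- Key step in the proof of Theorem 2(ii): for an equivariant wave function of weight
`m`, smooth near the origin, every iterated derivative at the origin of order `d` with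
`d < |m|` or `d ≢ m (mod 2)` vanishes identically. -/
theorem stmt7 (m : ℤ) (Ψ : ℝ × ℝ → ℂ) (hΨ : Equivariant m Ψ)
    (hsm : ∃ U ∈ 𝓝 (0 : ℝ × ℝ), ContDiffOn ℝ (⊤ : ℕ∞) Ψ U) :
    ∀ d : ℕ, ((d : ℤ) < |m| ∨ ¬ (2 ∣ (m - d))) → iteratedFDeriv ℝ d Ψ 0 = 0 := by
  intro d hd
  obtain ⟨U, hU, hc⟩ := hsm
  have hat : ContDiffAt ℝ d Ψ 0 := (hc.contDiffAt hU).of_le (by exact_mod_cast le_top)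
  have h := multilinear_zero d m hd (iteratedFDeriv ℝ d Ψ 0).toMultilinearMap ?_
  · ext v
    exact congrArg (fun S => S v) h
  intro α v
  have h1 : iteratedFDeriv ℝ d (Ψ ∘ rotEquiv α) 0 =
      (iteratedFDeriv ℝ d Ψ 0).compContinuousLinearMap fun _ => (rotEquiv α : (ℝ × ℝ) →L[ℝ] ℝ × ℝ) := by
    have := (rotEquiv α).iteratedFDerivWithin_comp_right Ψ (s := Set.univ) uniqueDiffOn_univ
      (x := 0) (Set.mem_univ _) d
    simpa [iteratedFDerivWithin_univ] using this
  have h2 : Ψ ∘ rotEquiv α = Complex.exp ((m : ℂ) * α * Complex.I) • Ψ := by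
    funext x
    exact hΨ α x
  rw [h2, iteratedFDeriv_const_smul_apply hat] at h1
  have h3 := congrArg (fun S => S v) h1
  exact h3.symm
end

section
/- Let r₁, r₂ ∈ ℝ³ be linearly independent, let R be a rotation matrix (R ∈ SO(3), i.e., RᵀR = I and det R = 1), and set r_{s1} = R r₁, r_{s2} = R r₂. Define v₁ = −r₂ × (r₂ × r₁) and v₂ = −r₁ × (r₁ × r₂). Then R is recovered by the explicit formula R = (1/‖r₁ × r₂‖²) [ r_{s1} v₁ᵀ + r_{s2} v₂ᵀ + (r_{s1} × r_{s2})(r₁ × r₂)ᵀ ], where for u, w ∈ ℝ³ the symbol u wᵀ denotes the 3×3 matrix (outer product) sending z ∈ ℝ³ to ⟨w, z⟩ u. In particular R(r₁ × r₂) = r_{s1} × r_{s2}, and these identities rest on the relations ⟨v_α, r_α⟩ = ‖r₁ × r₂‖², ⟨v_α, r₁ × r₂⟩ = 0 (α = 1,2), and ⟨v₁, r₂⟩ = ⟨v₂, r₁⟩ = 0. -/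
open Matrix

/-- Euclidean inner product on ℝ³. -/
def dot3 (a b : Fin 3 → ℝ) : ℝ := a 0 * b 0 + a 1 * b 1 + a 2 * b 2

/-- Euclidean norm on ℝ³. -/
noncomputable def nrm3 (a : Fin 3 → ℝ) : ℝ := Real.sqrt (dot3 a a)

/-- Cross product on ℝ³. -/
def cross3 (a b : Fin 3 → ℝ) : Fin 3 → ℝ :=
  ![a 1 * b 2 - a 2 * b 1, a 2 * b 0 - a 0 * b 2, a 0 * b 1 - a 1 * b 0]

/-- Explicit recovery of the orientation matrix `R ∈ SO(3)` from the body-referred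
Jacobi vectors `r₁, r₂` (noncollinear, i.e. linearly independent) and the space-referred
Jacobi vectors `r_{sα} = R r_α`, via the formula
`R = (1/‖r₁×r₂‖²)[r_{s1} v₁ᵀ + r_{s2} v₂ᵀ + (r_{s1}×r_{s2})(r₁×r₂)ᵀ]` with
`v₁ = −r₂×(r₂×r₁)`, `v₂ = −r₁×(r₁×r₂)`; in particular `R(r₁×r₂) = r_{s1}×r_{s2}`,
and the underlying dot-product relations hold. -/
theorem stmt12 (r₁ r₂ : Fin 3 → ℝ) (hli : LinearIndependent ℝ ![r₁, r₂])
    (R : Matrix (Fin 3) (Fin 3) ℝ) (hR : Rᵀ * R = 1) (hdet : R.det = 1)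
    (rs1 rs2 v₁ v₂ : Fin 3 → ℝ)
    (hrs1 : rs1 = R.mulVec r₁) (hrs2 : rs2 = R.mulVec r₂)
    (hv₁ : v₁ = -cross3 r₂ (cross3 r₂ r₁)) (hv₂ : v₂ = -cross3 r₁ (cross3 r₁ r₂)) :
    R = (1 / nrm3 (cross3 r₁ r₂) ^ 2) •
        (Matrix.vecMulVec rs1 v₁ + Matrix.vecMulVec rs2 v₂ +
          Matrix.vecMulVec (cross3 rs1 rs2) (cross3 r₁ r₂)) ∧
    R.mulVec (cross3 r₁ r₂) = cross3 rs1 rs2 ∧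
    dot3 v₁ r₁ = nrm3 (cross3 r₁ r₂) ^ 2 ∧
    dot3 v₂ r₂ = nrm3 (cross3 r₁ r₂) ^ 2 ∧
    dot3 v₁ (cross3 r₁ r₂) = 0 ∧
    dot3 v₂ (cross3 r₁ r₂) = 0 ∧
    dot3 v₁ r₂ = 0 ∧ dot3 v₂ r₁ = 0 := by
  have hadj : R.adjugate = Rᵀ := by
    have h1 : R * R.adjugate = 1 := by rw [Matrix.mul_adjugate, hdet, one_smul]
    calc R.adjugate = (Rᵀ * R) * R.adjugate := by rw [hR, Matrix.one_mul]
      _ = Rᵀ := by rw [Matrix.mul_assoc, h1, Matrix.mul_one]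
  have hN : nrm3 (cross3 r₁ r₂) ^ 2 = dot3 (cross3 r₁ r₂) (cross3 r₁ r₂) := by
    unfold nrm3
    apply Real.sq_sqrt
    unfold dot3
    nlinarith [mul_self_nonneg (cross3 r₁ r₂ 0), mul_self_nonneg (cross3 r₁ r₂ 1),
      mul_self_nonneg (cross3 r₁ r₂ 2)]
  have hc : cross3 r₁ r₂ ≠ 0 := by
    have h := crossProduct_ne_zero_iff_linearIndependent.mpr hli
    rwa [cross_apply] at h
  have hN0 : nrm3 (cross3 r₁ r₂) ^ 2 ≠ 0 := by
    rw [hN]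
    intro h
    apply hc
    unfold dot3 at h
    have h0 := mul_self_nonneg (cross3 r₁ r₂ 0)
    have h1 := mul_self_nonneg (cross3 r₁ r₂ 1)
    have h2 := mul_self_nonneg (cross3 r₁ r₂ 2)
    ext i
    fin_cases i
    · exact (mul_self_eq_zero.mp (by linarith) : cross3 r₁ r₂ 0 = 0)
    · exact (mul_self_eq_zero.mp (by linarith) : cross3 r₁ r₂ 1 = 0)
    · exact (mul_self_eq_zero.mp (by linarith) : cross3 r₁ r₂ 2 = 0)
  have hcross : R.mulVec (cross3 r₁ r₂) = cross3 rs1 rs2 := by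
    have hT : R = R.adjugateᵀ := by rw [hadj, Matrix.transpose_transpose]
    have key : R.adjugateᵀ.mulVec (cross3 r₁ r₂) = cross3 rs1 rs2 := by
      rw [hrs1, hrs2, Matrix.adjugate_fin_three]
      ext i
      fin_cases i <;>
        simp [cross3, Matrix.mulVec, dotProduct, Fin.sum_univ_three] <;> ring
    rwa [← hT] at key
  refine ⟨?_, hcross, ?_, ?_, ?_, ?_, ?_, ?_⟩
  · have hM : Matrix.vecMulVec r₁ v₁ + Matrix.vecMulVec r₂ v₂ +
        Matrix.vecMulVec (cross3 r₁ r₂) (cross3 r₁ r₂) =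
        (nrm3 (cross3 r₁ r₂) ^ 2) • (1 : Matrix (Fin 3) (Fin 3) ℝ) := by
      rw [hN, hv₁, hv₂]
      ext i j
      fin_cases i <;> fin_cases j <;>
        simp [cross3, dot3, Matrix.vecMulVec_apply] <;> ring
    rw [← hcross, hrs1, hrs2, ← Matrix.mul_vecMulVec, ← Matrix.mul_vecMulVec,
      ← Matrix.mul_vecMulVec, ← Matrix.mul_add, ← Matrix.mul_add, hM, Matrix.mul_smul,
      Matrix.mul_one, smul_smul, one_div, inv_mul_cancel₀ hN0, one_smul]
  all_goals
    first | rw [hN] | skip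
    simp only [hv₁, hv₂]
    simp [cross3, dot3]
    ring
end

section
/- Define W : ℝ³ × ℝ³ → ℝ³ by W(r₁, r₂) = (‖r₁‖² − ‖r₂‖², 2⟨r₁, r₂⟩, 2‖r₁ × r₂‖). Let (r₁, r₂) ∈ ℝ³ × ℝ³ and let f : ℝ³ → ℂ be real-analytic at the point W(r₁, r₂) and even in its third argument near that point, i.e., f(w₁, w₂, −w₃) = f(w₁, w₂, w₃) for all (w₁, w₂, w₃) in a neighborhood of W(r₁, r₂). Then the composite function (s₁, s₂) ↦ f(W(s₁, s₂)) is real-analytic at (r₁, r₂). -/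
open Filter Topology

/-- The w-coordinates `(w₁, w₂, w₃) = (r₁² − r₂², 2 r₁·r₂, 2|r₁ × r₂|)` on three-body
shape space, as a function of the pair of Jacobi vectors. -/
noncomputable def wCoords (p : (Fin 3 → ℝ) × (Fin 3 → ℝ)) : ℝ × ℝ × ℝ :=
  (nrm3 p.1 ^ 2 - nrm3 p.2 ^ 2, 2 * dot3 p.1 p.2, 2 * nrm3 (cross3 p.1 p.2))

noncomputable def extSeries {V A : Type*} [NormedAddCommGroup V] [NormedSpace ℝ V]
    [NormedRing A] [NormedAlgebra ℂ A] (p : FormalMultilinearSeries ℝ V ℂ) (e : Fin 3 → V) :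
    FormalMultilinearSeries ℝ (Fin 3 → A) A := fun n =>
  ∑ σ : Fin n → Fin 3, (p n (fun i => e (σ i))) •
    (ContinuousMultilinearMap.mkPiAlgebraFin ℝ n A).compContinuousLinearMap
      (fun i => ContinuousLinearMap.proj (R := ℝ) (φ := fun _ : Fin 3 => A) (σ i))

lemma extSeries_norm {V A : Type*} [NormedAddCommGroup V] [NormedSpace ℝ V]
    [NormedRing A] [NormedAlgebra ℂ A] [NormOneClass A]
    (p : FormalMultilinearSeries ℝ V ℂ) (e : Fin 3 → V)
    (he : ∀ j, ‖e j‖ ≤ 1) (n : ℕ) : ‖extSeries (A := A) p e n‖ ≤ 3 ^ n * ‖p n‖ := by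
  refine ContinuousMultilinearMap.opNorm_le_bound (by positivity) fun a => ?_
  have key : ∀ σ ∈ (Finset.univ : Finset (Fin n → Fin 3)), ‖((p n (fun i => e (σ i))) •
    (ContinuousMultilinearMap.mkPiAlgebraFin ℝ n A).compContinuousLinearMap
      (fun i => ContinuousLinearMap.proj (R := ℝ) (φ := fun _ : Fin 3 => A) (σ i))) a‖
      ≤ ‖p n‖ * ∏ i, ‖a i‖ := by
    intro σ _
    have h1 : ‖p n (fun i => e (σ i))‖ ≤ ‖p n‖ := by
      refine ((p n).le_opNorm _).trans ?_
      refine mul_le_of_le_one_right (norm_nonneg _) ?_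
      exact Finset.prod_le_one (fun i _ => norm_nonneg _) (fun i _ => he _)
    have h2 : ‖(ContinuousMultilinearMap.mkPiAlgebraFin ℝ n A) (fun i => a i (σ i))‖
        ≤ ∏ i, ‖a i‖ := by
      refine ((ContinuousMultilinearMap.mkPiAlgebraFin ℝ n A).le_opNorm _).trans ?_
      rw [ContinuousMultilinearMap.norm_mkPiAlgebraFin, one_mul]
      exact Finset.prod_le_prod (fun i _ => norm_nonneg _) (fun i _ => norm_le_pi_norm (a i) (σ i))
    change ‖(p n (fun i => e (σ i))) •
      (ContinuousMultilinearMap.mkPiAlgebraFin ℝ n A) (fun i => a i (σ i))‖ ≤ _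
    rw [norm_smul]
    exact mul_le_mul h1 h2 (norm_nonneg _) (norm_nonneg _)
  rw [extSeries, sum_apply]
  refine (norm_sum_le _ _).trans ((Finset.sum_le_sum key).trans ?_)
  simp [mul_assoc]

lemma extSeries_radius {V A : Type*} [NormedAddCommGroup V] [NormedSpace ℝ V]
    [NormedRing A] [NormedAlgebra ℂ A] [NormOneClass A]
    (p : FormalMultilinearSeries ℝ V ℂ) (e : Fin 3 → V)
    (he : ∀ j, ‖e j‖ ≤ 1) (hp : 0 < p.radius) : 0 < (extSeries (A := A) p e).radius := by
  obtain ⟨r, hr0, hr⟩ := ENNReal.lt_iff_exists_nnreal_btwn.1 hp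
  obtain ⟨C, hC, h⟩ := p.norm_mul_pow_le_of_lt_radius hr
  have hr0' : 0 < r := by exact_mod_cast hr0
  refine lt_of_lt_of_le ?_ ((extSeries (A := A) p e).le_radius_of_bound C (r := r / 3) ?_)
  · exact_mod_cast (by positivity : 0 < r / 3)
  · intro n
    refine le_trans ?_ (h n)
    calc _ ≤ (3 ^ n * ‖p n‖) * (((r / 3 : NNReal) : ℝ)) ^ n := by
            gcongr; exact extSeries_norm p e he n
      _ = _ := by push_cast; rw [div_pow]; field_simp

/-- key algebraic identity -/
lemma list_key {A : Type*} [Ring A] [Algebra ℂ A] (M : A) (x y z : ℝ)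
    (hM : M * M = ((z : ℂ) ^ 2) • (1 : A)) (n : ℕ) (σ : Fin n → Fin 3) :
    ∃ α β : ℂ, (List.ofFn fun i => (![(x : ℂ) • 1, (y : ℂ) • 1, M] : Fin 3 → A) (σ i)).prod
        = α • 1 + β • M ∧
      2 * α = (∏ i, ((![x, y, z] (σ i) : ℝ) : ℂ)) + ∏ i, ((![x, y, -z] (σ i) : ℝ) : ℂ) ∧
      2 * (β * z) = (∏ i, ((![x, y, z] (σ i) : ℝ) : ℂ)) - ∏ i, ((![x, y, -z] (σ i) : ℝ) : ℂ) := by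
  induction n with
  | zero => exact ⟨1, 0, by simp, by norm_num, by simp⟩
  | succ n ih =>
    obtain ⟨α, β, h1, h2, h3⟩ := ih (fun i => σ i.succ)
    rw [List.ofFn_succ, List.prod_cons, h1, Fin.prod_univ_succ, Fin.prod_univ_succ]
    generalize (∏ i : Fin n, ((![x, y, z] (σ i.succ) : ℝ) : ℂ)) = P at *
    generalize (∏ i : Fin n, ((![x, y, -z] (σ i.succ) : ℝ) : ℂ)) = P' at *
    generalize σ 0 = j
    fin_cases j
    · refine ⟨x * α, x * β, by simp [mul_smul, Complex.coe_smul], ?_, ?_⟩ <;> simp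
      · linear_combination x * h2
      · linear_combination x * h3
    · refine ⟨y * α, y * β, by simp [mul_smul, Complex.coe_smul], ?_, ?_⟩ <;> simp
      · linear_combination y * h2
      · linear_combination y * h3
    · refine ⟨β * z ^ 2, α, by simp [mul_add, hM, smul_smul, add_comm], ?_, ?_⟩ <;> simp
      · linear_combination z * h3
      · linear_combination z * h2

lemma p_diag {V : Type*} [NormedAddCommGroup V] [NormedSpace ℝ V]
    (p : FormalMultilinearSeries ℝ V ℂ) (e : Fin 3 → V) (v : Fin 3 → ℝ) (n : ℕ) :
    p n (fun _ => ∑ j, v j • e j) =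
      ∑ σ : Fin n → Fin 3, (p n fun i => e (σ i)) * ∏ i, ((v (σ i) : ℝ) : ℂ) := by
  have := (p n).toMultilinearMap.map_sum (fun (_ : Fin n) j => v j • e j)
  simp only [ContinuousMultilinearMap.coe_coe] at this
  rw [this]
  refine Finset.sum_congr rfl fun σ _ => ?_
  have := (p n).toMultilinearMap.map_smul_univ (fun i => v (σ i)) (fun i => e (σ i))
  simp only [ContinuousMultilinearMap.coe_coe] at this
  rw [this, ← Complex.ofReal_prod, Complex.real_smul, mul_comm]

lemma ext_diag {V A : Type*} [NormedAddCommGroup V] [NormedSpace ℝ V]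
    [NormedRing A] [NormedAlgebra ℂ A] (L : A →ₗ[ℂ] ℂ) (M : A)
    (hL1 : L 1 = 1) (hLM : L M = 0) (x y z : ℝ) (hM : M * M = ((z : ℂ) ^ 2) • (1 : A))
    (p : FormalMultilinearSeries ℝ V ℂ) (e : Fin 3 → V) (n : ℕ) :
    L (extSeries (A := A) p e n (fun _ => ![(x : ℂ) • 1, (y : ℂ) • 1, M])) =
     2⁻¹ * (p n (fun _ => ∑ j, (![x, y, z] : Fin 3 → ℝ) j • e j) +
       p n (fun _ => ∑ j, (![x, y, -z] : Fin 3 → ℝ) j • e j)) := by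
  rw [p_diag, p_diag, ← Finset.sum_add_distrib, Finset.mul_sum, extSeries,
    sum_apply, map_sum]
  refine Finset.sum_congr rfl fun σ _ => ?_
  obtain ⟨α, β, h1, h2, h3⟩ := list_key M x y z hM n σ
  have : (((p n fun i => e (σ i)) • (ContinuousMultilinearMap.mkPiAlgebraFin ℝ n A).compContinuousLinearMap
      (fun i => ContinuousLinearMap.proj (R := ℝ) (φ := fun _ : Fin 3 => A) (σ i)))
      (fun _ => ![(x : ℂ) • 1, (y : ℂ) • 1, M])) = (p n fun i => e (σ i)) • (α • (1 : A) + β • M) := by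
    rw [← h1]
    simp [ContinuousMultilinearMap.mkPiAlgebraFin_apply]
  rw [this]
  simp only [map_smul, map_add, hL1, hLM, smul_eq_mul]
  linear_combination (2⁻¹ * (p n fun i => e (σ i))) * h2

lemma analyticAt_coord1 (j : Fin 3) (q : (Fin 3 → ℝ) × (Fin 3 → ℝ)) :
    AnalyticAt ℝ (fun p : (Fin 3 → ℝ) × (Fin 3 → ℝ) => p.1 j) q :=
  ((ContinuousLinearMap.proj (R := ℝ) (φ := fun _ : Fin 3 => ℝ) j).comp
    (ContinuousLinearMap.fst ℝ (Fin 3 → ℝ) (Fin 3 → ℝ))).analyticAt q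

lemma analyticAt_coord2 (j : Fin 3) (q : (Fin 3 → ℝ) × (Fin 3 → ℝ)) :
    AnalyticAt ℝ (fun p : (Fin 3 → ℝ) × (Fin 3 → ℝ) => p.2 j) q :=
  ((ContinuousLinearMap.proj (R := ℝ) (φ := fun _ : Fin 3 => ℝ) j).comp
    (ContinuousLinearMap.snd ℝ (Fin 3 → ℝ) (Fin 3 → ℝ))).analyticAt q

lemma dot3_self_nonneg (a : Fin 3 → ℝ) : 0 ≤ dot3 a a := by
  unfold dot3; nlinarith [mul_self_nonneg (a 0), mul_self_nonneg (a 1), mul_self_nonneg (a 2)]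

lemma nrm3_sq (a : Fin 3 → ℝ) : nrm3 a ^ 2 = dot3 a a := Real.sq_sqrt (dot3_self_nonneg a)

lemma analyticAt_dot3 {u v : (Fin 3 → ℝ) × (Fin 3 → ℝ) → Fin 3 → ℝ} {q}
    (hu : ∀ j, AnalyticAt ℝ (fun p => u p j) q) (hv : ∀ j, AnalyticAt ℝ (fun p => v p j) q) :
    AnalyticAt ℝ (fun p => dot3 (u p) (v p)) q :=
  (((hu 0).mul (hv 0)).add ((hu 1).mul (hv 1))).add ((hu 2).mul (hv 2))

lemma analyticAt_cross3 (j : Fin 3) (q : (Fin 3 → ℝ) × (Fin 3 → ℝ)) :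
    AnalyticAt ℝ (fun p : (Fin 3 → ℝ) × (Fin 3 → ℝ) => cross3 p.1 p.2 j) q := by
  have key : ∀ a b : Fin 3, AnalyticAt ℝ
      (fun p : (Fin 3 → ℝ) × (Fin 3 → ℝ) => p.1 a * p.2 b - p.1 b * p.2 a) q := fun a b =>
    ((analyticAt_coord1 a q).mul (analyticAt_coord2 b q)).sub
      ((analyticAt_coord1 b q).mul (analyticAt_coord2 a q))
  fin_cases j
  · exact key 1 2
  · exact key 2 0
  · exact key 0 1

lemma analyticAt_w1 (q : (Fin 3 → ℝ) × (Fin 3 → ℝ)) :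
    AnalyticAt ℝ (fun p => (wCoords p).1) q := by
  simp only [wCoords, nrm3_sq]
  exact (analyticAt_dot3 (fun j => analyticAt_coord1 j q) (fun j => analyticAt_coord1 j q)).sub
    (analyticAt_dot3 (fun j => analyticAt_coord2 j q) (fun j => analyticAt_coord2 j q))

lemma analyticAt_w2 (q : (Fin 3 → ℝ) × (Fin 3 → ℝ)) :
    AnalyticAt ℝ (fun p => (wCoords p).2.1) q := by
  simp only [wCoords]
  exact analyticAt_const.mul
    (analyticAt_dot3 (fun j => analyticAt_coord1 j q) (fun j => analyticAt_coord2 j q))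

lemma analyticAt_dcross (q : (Fin 3 → ℝ) × (Fin 3 → ℝ)) :
    AnalyticAt ℝ (fun p : (Fin 3 → ℝ) × (Fin 3 → ℝ) =>
      dot3 (cross3 p.1 p.2) (cross3 p.1 p.2)) q :=
  analyticAt_dot3 (fun j => analyticAt_cross3 j q) (fun j => analyticAt_cross3 j q)

lemma continuous_w3 : Continuous (fun p => (wCoords p).2.2) := by
  simp only [wCoords, nrm3]
  have : Continuous (fun p : (Fin 3 → ℝ) × (Fin 3 → ℝ) =>
      dot3 (cross3 p.1 p.2) (cross3 p.1 p.2)) :=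
    continuous_iff_continuousAt.2 fun q => (analyticAt_dcross q).continuousAt
  exact continuous_const.mul this.sqrt

lemma continuous_w : Continuous wCoords :=
  (continuous_iff_continuousAt.2 fun q => (analyticAt_w1 q).continuousAt).prodMk
    ((continuous_iff_continuousAt.2 fun q => (analyticAt_w2 q).continuousAt).prodMk continuous_w3)

lemma regular_case (q : (Fin 3 → ℝ) × (Fin 3 → ℝ))
    (h : dot3 (cross3 q.1 q.2) (cross3 q.1 q.2) ≠ 0) : AnalyticAt ℝ wCoords q := by
  have h3 : AnalyticAt ℝ (fun p => (wCoords p).2.2) q := by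
    simp only [wCoords, nrm3]
    refine analyticAt_const.mul ?_
    have hs : AnalyticAt ℝ (fun x => √x) (dot3 (cross3 q.1 q.2) (cross3 q.1 q.2)) :=
      (Real.contDiffAt_sqrt (n := ⊤) h).analyticAt
    exact AnalyticAt.fun_comp (f := fun p : (Fin 3 → ℝ) × (Fin 3 → ℝ) =>
      dot3 (cross3 p.1 p.2) (cross3 p.1 p.2)) hs (analyticAt_dcross q)
  exact (analyticAt_w1 q).prod ((analyticAt_w2 q).prod h3)

lemma singular_case {A : Type*} [NormedRing A] [NormedAlgebra ℂ A] [NormOneClass A]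
    [CompleteSpace A] (L : A →L[ℂ] ℂ) (m : Fin 3 → A) (hL1 : L 1 = 1) (hLm : ∀ j, L (m j) = 0)
    (hm : ∀ c : Fin 3 → ℝ, (∑ j, c j • m j) * (∑ j, c j • m j) = ((dot3 c c : ℝ) : ℂ) • (1 : A))
    (q : (Fin 3 → ℝ) × (Fin 3 → ℝ)) (f : ℝ × ℝ × ℝ → ℂ)
    (h : dot3 (cross3 q.1 q.2) (cross3 q.1 q.2) = 0)
    (hf : AnalyticAt ℝ f (wCoords q))
    (heven : ∀ᶠ w in 𝓝 (wCoords q), f (w.1, w.2.1, -w.2.2) = f w) :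
    AnalyticAt ℝ (fun p => f (wCoords p)) q := by
  obtain ⟨p, r, hp⟩ := hf
  let e : Fin 3 → ℝ × ℝ × ℝ := ![(1, 0, 0), (0, 1, 0), (0, 0, 1)]
  have he : ∀ j, ‖e j‖ ≤ 1 := by
    intro j; fin_cases j <;> simp [e, Prod.norm_def]
  have hQ := extSeries_radius (A := A) p e he (hp.r_pos.trans_le hp.r_le)
  set Q := extSeries (A := A) p e with hQdef
  have hball := Q.hasFPowerSeriesOnBall hQ
  let M : (Fin 3 → ℝ) × (Fin 3 → ℝ) → A := fun s => ∑ j, (2 * cross3 s.1 s.2 j) • m j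
  let Φ : (Fin 3 → ℝ) × (Fin 3 → ℝ) → Fin 3 → A := fun s =>
    ![((wCoords s).1 - (wCoords q).1) • (1 : A), ((wCoords s).2.1 - (wCoords q).2.1) • (1 : A), M s]
  have hc0 : ∀ j, cross3 q.1 q.2 j = 0 := by
    unfold dot3 at h
    intro j
    generalize cross3 q.1 q.2 = c at *
    fin_cases j <;> refine mul_self_eq_zero.1 ?_ <;> dsimp <;>
    nlinarith [mul_self_nonneg (c 0), mul_self_nonneg (c 1), mul_self_nonneg (c 2)]
  have hw3 : (wCoords q).2.2 = 0 := by simp [wCoords, nrm3, h]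
  have hΦ0 : Φ q = 0 := by
    ext j; fin_cases j <;> simp [Φ, M, hc0]
  have hΦ : AnalyticAt ℝ Φ q := by
    refine AnalyticAt.pi fun j => ?_
    fin_cases j
    · exact ((analyticAt_w1 q).sub analyticAt_const).smul analyticAt_const
    · exact ((analyticAt_w2 q).sub analyticAt_const).smul analyticAt_const
    · change AnalyticAt ℝ (fun s => ∑ j, (2 * cross3 s.1 s.2 j) • m j) q
      exact Finset.analyticAt_fun_sum _ fun j _ =>
        (analyticAt_const.mul (analyticAt_cross3 j q)).smul analyticAt_const
  have hG : AnalyticAt ℝ (fun s => L (Q.sum (Φ s))) q := by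
    have h1 : AnalyticAt ℝ Q.sum (Φ q) := by rw [hΦ0]; exact hball.analyticAt
    have h2 := h1.fun_comp hΦ
    exact ((L.restrictScalars ℝ).analyticAt _).fun_comp h2
  refine hG.congr ?_
  have e1 : ∀ᶠ s in 𝓝 q, Φ s ∈ Metric.eball (0 : Fin 3 → A) Q.radius :=
    hΦ.continuousAt.eventually_mem (by rw [hΦ0]; exact Metric.eball_mem_nhds _ hQ)
  have e2 : ∀ᶠ s in 𝓝 q, wCoords s ∈ Metric.eball (wCoords q) r :=
    continuous_w.continuousAt.eventually_mem (Metric.eball_mem_nhds _ hp.r_pos)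
  have cneg : Continuous (fun s => ((wCoords s).1, (wCoords s).2.1, -(wCoords s).2.2)) := by
    exact (continuous_fst.comp continuous_w).prodMk
      (((continuous_fst.comp continuous_snd).comp continuous_w).prodMk continuous_w3.neg)
  have e3 : ∀ᶠ s in 𝓝 q, ((wCoords s).1, (wCoords s).2.1, -(wCoords s).2.2)
      ∈ Metric.eball (wCoords q) r := by
    refine cneg.continuousAt.eventually_mem ?_
    have : ((wCoords q).1, (wCoords q).2.1, -(wCoords q).2.2) = wCoords q := by
      ext <;> simp [hw3]
    rw [this]
    exact Metric.eball_mem_nhds _ hp.r_pos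
  have e4 := continuous_w.continuousAt.eventually heven
  filter_upwards [e1, e2, e3, e4] with s h1 h2 h3 h4
  have s1 := (hball.hasSum h1).mapL L
  have s2 := hp.hasSum_sub h2
  have s3 := hp.hasSum_sub h3
  have hsq : M s * M s = (((wCoords s).2.2 : ℝ) : ℂ) ^ 2 • (1 : A) := by
    rw [hm]
    congr 1
    rw [← Complex.ofReal_pow]
    congr 1
    simp only [wCoords, mul_pow, nrm3_sq]
    unfold dot3
    ring
  have hLM : L (M s) = 0 := by
    simp only [M, map_sum]
    refine Finset.sum_eq_zero fun j _ => ?_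
    rw [← Complex.coe_smul, map_smul, hLm, smul_zero]
  have hd := fun n => ext_diag (L : A →ₗ[ℂ] ℂ) (M s) hL1 hLM ((wCoords s).1 - (wCoords q).1)
    ((wCoords s).2.1 - (wCoords q).2.1) (wCoords s).2.2 hsq p e n
  have v1 : ∑ j, (![(wCoords s).1 - (wCoords q).1, (wCoords s).2.1 - (wCoords q).2.1,
      (wCoords s).2.2] : Fin 3 → ℝ) j • e j = wCoords s - wCoords q := by
    ext <;> simp [Fin.sum_univ_three, e, hw3]
  have v2 : ∑ j, (![(wCoords s).1 - (wCoords q).1, (wCoords s).2.1 - (wCoords q).2.1,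
      -(wCoords s).2.2] : Fin 3 → ℝ) j • e j =
      ((wCoords s).1, (wCoords s).2.1, -(wCoords s).2.2) - wCoords q := by
    ext <;> simp [Fin.sum_univ_three, e, hw3]
  rw [v1, v2] at hd
  simp only [Complex.coe_smul] at hd
  have s4 := (s2.add s3).mul_left (2⁻¹ : ℂ)
  have : (fun n => L (Q n fun _ => Φ s)) = fun n => 2⁻¹ * ((p n fun _ => wCoords s - wCoords q) +
      p n fun _ => ((wCoords s).1, (wCoords s).2.1, -(wCoords s).2.2) - wCoords q) :=
    funext hd
  rw [this] at s1
  have s5 := s1.unique s4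
  rw [zero_add] at s5
  change L (Q.sum (Φ s)) = _
  rw [s5, h4]
  ring

section PauliMatrices

attribute [local instance] Matrix.linftyOpNormedRing Matrix.linftyOpNormedAlgebra
  Matrix.linfty_opNormOneClass

lemma pauli_case (q : (Fin 3 → ℝ) × (Fin 3 → ℝ)) (f : ℝ × ℝ × ℝ → ℂ)
    (h : dot3 (cross3 q.1 q.2) (cross3 q.1 q.2) = 0)
    (hf : AnalyticAt ℝ f (wCoords q))
    (heven : ∀ᶠ w in 𝓝 (wCoords q), f (w.1, w.2.1, -w.2.2) = f w) :
    AnalyticAt ℝ (fun p => f (wCoords p)) q := by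
  let L : Matrix (Fin 2) (Fin 2) ℂ →ₗ[ℂ] ℂ := (2⁻¹ : ℂ) • Matrix.traceLinearMap (Fin 2) ℂ ℂ
  have : CompleteSpace (Matrix (Fin 2) (Fin 2) ℂ) := FiniteDimensional.complete ℂ _
  refine singular_case (A := Matrix (Fin 2) (Fin 2) ℂ) (LinearMap.toContinuousLinearMap L)
    ![!![0, 1; 1, 0], !![0, -Complex.I; Complex.I, 0], !![1, 0; 0, -1]] ?_ ?_ ?_ q f h hf heven
  · simp [L]
  · intro j
    fin_cases j <;> simp [L, Matrix.trace_fin_two]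
  · intro c
    ext i j
    fin_cases i <;> fin_cases j <;>
      simp [Fin.sum_univ_three, Matrix.mul_apply, Fin.sum_univ_two, dot3] <;>
      ring_nf <;> simp [Complex.I_sq]

end PauliMatrices

/-- The w-coordinate instance of Lemma 1: an analytic function of the w-coordinates
that is even in `w₃` is an analytic function of the Jacobi vectors. -/
theorem stmt17 (r₁ r₂ : Fin 3 → ℝ) (f : ℝ × ℝ × ℝ → ℂ)
    (hf : AnalyticAt ℝ f (wCoords (r₁, r₂)))
    (heven : ∀ᶠ w in 𝓝 (wCoords (r₁, r₂)), f (w.1, w.2.1, -w.2.2) = f w) :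
    AnalyticAt ℝ (fun p : (Fin 3 → ℝ) × (Fin 3 → ℝ) => f (wCoords p)) (r₁, r₂) := by
  by_cases h : dot3 (cross3 r₁ r₂) (cross3 r₁ r₂) = 0
  · exact pauli_case (r₁, r₂) f h hf heven
  · exact hf.fun_comp (regular_case (r₁, r₂) h)
end

section
/- Let (w₁, w₂, w₃) ∈ ℝ³, set w = √(w₁² + w₂² + w₃²), and assume w + w₁ > 0. Define r₁ = √((w + w₁)/2) · ẑ and r₂ = (1/√(2(w + w₁))) · (w₃ x̂ + w₂ ẑ), where x̂, ŷ, ẑ is the standard orthonormal basis of ℝ³. Then ‖r₁‖² − ‖r₂‖² = w₁, 2⟨r₁, r₂⟩ = w₂, and 2‖r₁ × r₂‖ = |w₃|. -/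
/-- The reference configuration of the zxz body frame realizes the prescribed shape:
with `w = √(w₁²+w₂²+w₃²)` and `w + w₁ > 0`, the vectors
`r₁ = √((w+w₁)/2) ẑ` and `r₂ = (w₃ x̂ + w₂ ẑ)/√(2(w+w₁))` satisfy
`‖r₁‖² − ‖r₂‖² = w₁`, `2⟨r₁,r₂⟩ = w₂`, `2‖r₁×r₂‖ = |w₃|`. -/
theorem stmt18 (w₁ w₂ w₃ : ℝ)
    (hpos : 0 < Real.sqrt (w₁ ^ 2 + w₂ ^ 2 + w₃ ^ 2) + w₁)
    (w : ℝ) (hw : w = Real.sqrt (w₁ ^ 2 + w₂ ^ 2 + w₃ ^ 2))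
    (r₁ r₂ : Fin 3 → ℝ)
    (hr₁ : r₁ = Real.sqrt ((w + w₁) / 2) • (![0, 0, 1] : Fin 3 → ℝ))
    (hr₂ : r₂ = (1 / Real.sqrt (2 * (w + w₁))) •
      (w₃ • (![1, 0, 0] : Fin 3 → ℝ) + w₂ • (![0, 0, 1] : Fin 3 → ℝ))) :
    nrm3 r₁ ^ 2 - nrm3 r₂ ^ 2 = w₁ ∧ 2 * dot3 r₁ r₂ = w₂ ∧
      2 * nrm3 (cross3 r₁ r₂) = |w₃| := by
  rw [← hw] at hpos
  have hsq : w ^ 2 = w₁ ^ 2 + w₂ ^ 2 + w₃ ^ 2 := by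
    rw [hw]; exact Real.sq_sqrt (by positivity)
  have hb : Real.sqrt (2 * (w + w₁)) = 2 * Real.sqrt ((w + w₁) / 2) := by
    rw [show 2 * (w + w₁) = 2 ^ 2 * ((w + w₁) / 2) by ring,
      Real.sqrt_mul (by norm_num), Real.sqrt_sq (by norm_num)]
  have ha2 : Real.sqrt ((w + w₁) / 2) ^ 2 = (w + w₁) / 2 := Real.sq_sqrt (by linarith)
  have ha : 0 < Real.sqrt ((w + w₁) / 2) := Real.sqrt_pos.mpr (by linarith)
  rw [hb] at hr₂
  generalize Real.sqrt ((w + w₁) / 2) = a at *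
  have hne : a ≠ 0 := ha.ne'
  have e10 : r₁ 0 = 0 := by simp [hr₁]
  have e11 : r₁ 1 = 0 := by simp [hr₁]
  have e12 : r₁ 2 = a := by simp [hr₁]
  have e20 : r₂ 0 = w₃ / (2 * a) := by simp [hr₂]; field_simp
  have e21 : r₂ 1 = 0 := by simp [hr₂]
  have e22 : r₂ 2 = w₂ / (2 * a) := by simp [hr₂]; field_simp
  have hn : ∀ v : Fin 3 → ℝ, nrm3 v ^ 2 = dot3 v v := by
    intro v
    refine Real.sq_sqrt ?_
    unfold dot3
    nlinarith [mul_self_nonneg (v 0), mul_self_nonneg (v 1), mul_self_nonneg (v 2)]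
  refine ⟨?_, ?_, ?_⟩
  · rw [hn, hn]
    simp only [dot3, e10, e11, e12, e20, e21, e22]
    have hw1 : w₁ = 2 * a ^ 2 - w := by linarith
    have h4 : w₃ ^ 2 + w₂ ^ 2 = 4 * a ^ 2 * (w - a ^ 2) := by
      rw [hw1] at hsq; linarith
    have : w₃ / (2 * a) * (w₃ / (2 * a)) + w₂ / (2 * a) * (w₂ / (2 * a)) = w - a ^ 2 := by
      field_simp
      linarith
    linarith
  · simp only [dot3, e10, e11, e12, e20, e21, e22]
    field_simp
    ring
  · have h : dot3 (cross3 r₁ r₂) (cross3 r₁ r₂) = (w₃ / 2) ^ 2 := by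
      simp [dot3, cross3, e10, e11, e12, e20, e21, e22]
      field_simp
    rw [nrm3, h, Real.sqrt_sq_eq_abs, abs_div, abs_two]
    ring
end

section
/- Let (w₁, w₂, w₃) ∈ ℝ³ with w₃ ≥ 0 and w₂ ≠ 0, set w = √(w₁² + w₂² + w₃²), a = √(w + w₃), b = √(w − w₃), and σ = w₂/|w₂|. Define r₁ = [((a+b)/(2√2)) (1 + w₁/(ab))^{1/2} σ] ẑ − [((a−b)/(2√2)) (1 − w₁/(ab))^{1/2}] x̂ and r₂ = [((a+b)/(2√2)) (1 − w₁/(ab))^{1/2}] ẑ + [((a−b)/(2√2)) (1 + w₁/(ab))^{1/2} σ] x̂, where x̂, ŷ, ẑ is the standard orthonormal basis of ℝ³ (note ab = √(w₁² + w₂²) > 0 and |w₁| ≤ ab, so all square roots are real). Then ‖r₁‖² − ‖r₂‖² = w₁, 2⟨r₁, r₂⟩ = w₂, 2‖r₁ × r₂‖ = w₃, and moreover the frame axes are principal axes of the configuration: (r₁)_x (r₁)_z + (r₂)_x (r₂)_z = 0. -/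
/-- The reference configuration of the principal-axis body frame realizes the
prescribed shape `(w₁, w₂, w₃)` (with `w₃ ≥ 0`, `w₂ ≠ 0`) and lies along principal
axes: with `w = √(w₁²+w₂²+w₃²)`, `a = √(w+w₃)`, `b = √(w−w₃)`, `σ = w₂/|w₂|`, the
stated vectors `r₁, r₂` satisfy `‖r₁‖² − ‖r₂‖² = w₁`, `2⟨r₁,r₂⟩ = w₂`,
`2‖r₁×r₂‖ = w₃`, and `(r₁)ₓ(r₁)_z + (r₂)ₓ(r₂)_z = 0`. -/
theorem stmt19 (w₁ w₂ w₃ : ℝ) (hw₃ : 0 ≤ w₃) (hw₂ : w₂ ≠ 0)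
    (w a b σ : ℝ)
    (hw : w = Real.sqrt (w₁ ^ 2 + w₂ ^ 2 + w₃ ^ 2))
    (ha : a = Real.sqrt (w + w₃)) (hb : b = Real.sqrt (w - w₃))
    (hσ : σ = w₂ / |w₂|)
    (r₁ r₂ : Fin 3 → ℝ)
    (hr₁ : r₁ = ((a + b) / (2 * Real.sqrt 2) * Real.sqrt (1 + w₁ / (a * b)) * σ) •
        (![0, 0, 1] : Fin 3 → ℝ) -
      ((a - b) / (2 * Real.sqrt 2) * Real.sqrt (1 - w₁ / (a * b))) •
        (![1, 0, 0] : Fin 3 → ℝ))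
    (hr₂ : r₂ = ((a + b) / (2 * Real.sqrt 2) * Real.sqrt (1 - w₁ / (a * b))) •
        (![0, 0, 1] : Fin 3 → ℝ) +
      ((a - b) / (2 * Real.sqrt 2) * Real.sqrt (1 + w₁ / (a * b)) * σ) •
        (![1, 0, 0] : Fin 3 → ℝ)) :
    nrm3 r₁ ^ 2 - nrm3 r₂ ^ 2 = w₁ ∧ 2 * dot3 r₁ r₂ = w₂ ∧
      2 * nrm3 (cross3 r₁ r₂) = w₃ ∧ r₁ 0 * r₁ 2 + r₂ 0 * r₂ 2 = 0 := by
  have hw2p : 0 < w₂ ^ 2 := by positivity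
  have hS : 0 ≤ w₁ ^ 2 + w₂ ^ 2 + w₃ ^ 2 := by positivity
  have hwsq : w ^ 2 = w₁ ^ 2 + w₂ ^ 2 + w₃ ^ 2 := by rw [hw, Real.sq_sqrt hS]
  have hw0 : 0 ≤ w := by rw [hw]; exact Real.sqrt_nonneg _
  have hlt : w₃ < w := by
    apply lt_of_pow_lt_pow_left₀ 2 hw0
    nlinarith [sq_nonneg w₁]
  have ha0 : 0 < a := by rw [ha]; exact Real.sqrt_pos.mpr (by linarith)
  have hb0 : 0 < b := by rw [hb]; exact Real.sqrt_pos.mpr (by linarith)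
  have ha2 : a ^ 2 = w + w₃ := by rw [ha, Real.sq_sqrt (by linarith)]
  have hb2 : b ^ 2 = w - w₃ := by rw [hb, Real.sq_sqrt (by linarith)]
  have hab : 0 < a * b := mul_pos ha0 hb0
  have hab2 : (a * b) ^ 2 = w₁ ^ 2 + w₂ ^ 2 := by
    rw [mul_pow, ha2, hb2]; linarith
  have habs : |w₁| ≤ a * b := abs_le_of_sq_le_sq (by linarith) hab.le
  obtain ⟨h1, h2⟩ := abs_le.mp habs
  have hta : w₁ / (a * b) * (a * b) = w₁ := div_mul_cancel₀ _ hab.ne'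
  have ht1 : 0 ≤ 1 + w₁ / (a * b) := by
    have : -1 ≤ w₁ / (a * b) := by rw [le_div_iff₀ hab]; linarith
    linarith
  have ht2 : 0 ≤ 1 - w₁ / (a * b) := by
    have : w₁ / (a * b) ≤ 1 := by rw [div_le_iff₀ hab]; linarith
    linarith
  have hcs : Real.sqrt (1 + w₁ / (a * b)) * Real.sqrt (1 - w₁ / (a * b)) * (a * b) = |w₂| := by
    rw [← Real.sqrt_mul ht1, ← Real.sqrt_sq_eq_abs]
    symm
    rw [Real.sqrt_eq_iff_mul_self_eq (by positivity) (by positivity)]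
    symm
    have := Real.mul_self_sqrt (mul_nonneg ht1 ht2)
    calc _ = (Real.sqrt ((1 + w₁ / (a * b)) * (1 - w₁ / (a * b))) *
        Real.sqrt ((1 + w₁ / (a * b)) * (1 - w₁ / (a * b)))) * (a * b) ^ 2 := by ring
      _ = (a * b) ^ 2 - (w₁ / (a * b) * (a * b)) ^ 2 := by rw [this]; ring
      _ = _ := by rw [hta, hab2]; ring
  have hc2 := Real.sq_sqrt ht1
  have hs2 := Real.sq_sqrt ht2
  have hσ2 : σ ^ 2 = 1 := by
    rw [hσ, div_pow, sq_abs, div_self hw2p.ne']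
  have hσw : σ * |w₂| = w₂ := by
    rw [hσ, div_mul_cancel₀ _ (abs_pos.mpr hw₂).ne']
  have hr2 : (0 : ℝ) < Real.sqrt 2 := by positivity
  have hr22 : Real.sqrt 2 ^ 2 = 2 := Real.sq_sqrt (by norm_num)
  obtain ⟨p, hp⟩ : ∃ p, p = (a + b) / (2 * Real.sqrt 2) := ⟨_, rfl⟩
  obtain ⟨q, hq⟩ : ∃ q, q = (a - b) / (2 * Real.sqrt 2) := ⟨_, rfl⟩
  have hpq1 : 2 * (p ^ 2 - q ^ 2) = a * b := by
    rw [hp, hq, div_pow, div_pow, mul_pow, hr22]; ring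
  have hpq2 : 4 * (p * q) = w₃ := by
    rw [hp, hq, div_mul_div_comm, ← sq (2 * Real.sqrt 2), mul_pow, hr22]
    linear_combination (ha2 - hb2) / 2
  rw [← hp, ← hq] at hr₁ hr₂
  generalize Real.sqrt (1 + w₁ / (a * b)) = c at *
  generalize Real.sqrt (1 - w₁ / (a * b)) = s at *
  generalize w₁ / (a * b) = t at *
  have e10 : r₁ 0 = -(q * s) := by rw [hr₁]; simp
  have e11 : r₁ 1 = 0 := by rw [hr₁]; simp
  have e12 : r₁ 2 = p * c * σ := by rw [hr₁]; simp
  have e20 : r₂ 0 = q * c * σ := by rw [hr₂]; simp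
  have e21 : r₂ 1 = 0 := by rw [hr₂]; simp
  have e22 : r₂ 2 = p * s := by rw [hr₂]; simp
  have hn : ∀ v, nrm3 v ^ 2 = dot3 v v := fun v => by
    unfold nrm3
    apply Real.sq_sqrt
    unfold dot3
    nlinarith [mul_self_nonneg (v 0), mul_self_nonneg (v 1), mul_self_nonneg (v 2)]
  refine ⟨?_, ?_, ?_, ?_⟩
  · rw [hn, hn]
    simp only [dot3, e10, e11, e12, e20, e21, e22]
    linear_combination (p ^ 2 - q ^ 2) * (c ^ 2 * hσ2 + hc2 - hs2) + t * hpq1 + hta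
  · simp only [dot3, e10, e11, e12, e20, e21, e22]
    linear_combination c * s * σ * hpq1 + σ * hcs + hσw
  · have hd : dot3 (cross3 r₁ r₂) (cross3 r₁ r₂) = (w₃ / 2) ^ 2 := by
      have hy : r₁ 2 * r₂ 0 - r₁ 0 * r₂ 2 = w₃ / 2 := by
        rw [e10, e12, e20, e22]
        linear_combination p * q * (c ^ 2 * hσ2 + hc2 + hs2) + hpq2 / 2
      have hx : cross3 r₁ r₂ 0 = 0 := by simp [cross3, e11, e21]
      have hz : cross3 r₁ r₂ 2 = 0 := by simp [cross3, e11, e21]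
      have hy2 : cross3 r₁ r₂ 1 = w₃ / 2 := by rw [← hy]; simp [cross3]
      rw [dot3, hx, hz, hy2]; ring
    rw [nrm3, hd, Real.sqrt_sq (by linarith)]; ring
  · rw [e10, e12, e20, e22]; ring
end
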